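/- arXiv:1901.10773 — 3 statements merged into one kernel-verified Lean document; each statement's English description precedes it below -/
import Mathlib

section
/- For every n ∈ ℕ there exists a countable ARS with two relations (A,→,⇝) that belongs to DC_{5n+1} but does not belong to DC_n. -/
open Relation Function FirstOrder

/-- Reflexive–transitive–symmetric closure (convertibility `↔*`). -/
def Conv {A : Type} (r : A → A → Prop) : A → A → Prop :=
  Relation.ReflTransGen (fun x y => r x y ∨ r y x)

/-- Confluence (CR). -/
def Confluent {A : Type} (r : A → A → Prop) : Prop :=
  ∀ a b c, Relation.ReflTransGen r a b → Relation.ReflTransGen r a c →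
    ∃ d, Relation.ReflTransGen r b d ∧ Relation.ReflTransGen r c d

/-- Local confluence (WCR). -/
def LocallyConfluent {A : Type} (r : A → A → Prop) : Prop :=
  ∀ a b c, r a b → r a c →
    ∃ d, Relation.ReflTransGen r b d ∧ Relation.ReflTransGen r c d

/-- Strong confluence (SC). -/
def StronglyConfluent {A : Type} (r : A → A → Prop) : Prop :=
  ∀ a b c, r a b → r a c →
    ∃ d, (r b d ∨ b = d) ∧ Relation.ReflTransGen r c d

def IsNormalForm {A : Type} (r : A → A → Prop) (a : A) : Prop := ¬ ∃ b, r a b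

/-- Unique normal forms (UN). -/
def UN {A : Type} (r : A → A → Prop) : Prop :=
  ∀ a b, IsNormalForm r a → IsNormalForm r b → Conv r a b → a = b

/-- Unique normal forms w.r.t. reduction (UN→). -/
def UNred {A : Type} (r : A → A → Prop) : Prop :=
  ∀ a b x, IsNormalForm r a → IsNormalForm r b →
    Relation.ReflTransGen r x a → Relation.ReflTransGen r x b → a = b

/-- Normal form property (NFP). -/
def NFP {A : Type} (r : A → A → Prop) : Prop :=
  ∀ a b, IsNormalForm r b → Conv r a b → Relation.ReflTransGen r a b

/-- Acyclicity (AC). -/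
def Acyclic {A : Type} (r : A → A → Prop) : Prop :=
  ∀ a b, Relation.TransGen r a b → a ≠ b

/-- Strong normalisation (SN): no infinite rewrite sequence. -/
def SN {A : Type} (r : A → A → Prop) : Prop :=
  ¬ ∃ f : ℕ → A, ∀ i, r (f i) (f (i + 1))

/-- Weak normalisation (WN). -/
def WN {A : Type} (r : A → A → Prop) : Prop :=
  ∀ a, ∃ b, Relation.ReflTransGen r a b ∧ IsNormalForm r b

/-- Inductive (IND). -/
def Inductive {A : Type} (r : A → A → Prop) : Prop :=
  ∀ f : ℕ → A, (∀ i, r (f i) (f (i + 1))) → ∃ a, ∀ i, Relation.ReflTransGen r (f i) a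

/-- Increasing (INC). -/
def Increasing {A : Type} (r : A → A → Prop) : Prop :=
  ∃ f : A → ℕ, ∀ a b, r a b → f a < f b

/-- A (finite or infinite) reduction sequence. -/
def IsRedSeq {A : Type} (r : A → A → Prop) (f : ℕ → A) : Prop :=
  ∀ i, r (f i) (f (i + 1)) ∨ ∀ j, i ≤ j → f j = f i

/-- Restriction of a relation to a subset. -/
def Restrict {A : Type} (r : A → A → Prop) (S : Set A) : A → A → Prop :=
  fun x y => r x y ∧ x ∈ S ∧ y ∈ S

/-- `f` is cofinal in the restriction of `(A, r)` to `S`. -/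
def CofinalIn {A : Type} (r : A → A → Prop) (S : Set A) (f : ℕ → A) : Prop :=
  ∀ b ∈ S, ∃ i, Relation.ReflTransGen (Restrict r S) b (f i)

/-- Cofinality property (CP). -/
def CP {A : Type} (r : A → A → Prop) : Prop :=
  ∀ a, ∃ f : ℕ → A, IsRedSeq r f ∧ f 0 = a ∧
    (∀ i, Relation.ReflTransGen r a (f i)) ∧
    CofinalIn r {b | Relation.ReflTransGen r a b} f

/-! First-order logic over the language with equality and one binary relation symbol. -/

/-- The `L`-structure on `A` interpreting the binary relation symbol as `r`. -/
def arsStructure (A : Type) (r : A → A → Prop) : FirstOrder.Language.order.Structure A :=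
  ⟨fun f => Empty.elim f, fun {n} R v =>
    match n, R with
    | 2, .le => r (v 0) (v 1)⟩

/-- `(A, r)` models the set of sentences `Φ`. -/
def ModelsSet (A : Type) (r : A → A → Prop) (Φ : Set (FirstOrder.Language.order.Sentence)) :
    Prop :=
  ∀ φ ∈ Φ, @FirstOrder.Language.Sentence.Realize FirstOrder.Language.order A (arsStructure A r) φ

/-- `P` is a generalised first-order property of ARSs. -/
def IsGFOP (P : ∀ A : Type, (A → A → Prop) → Prop) : Prop :=
  ∃ Φ : Set (FirstOrder.Language.order.Sentence),
    ∀ (A : Type), Nonempty A → ∀ r : A → A → Prop, (ModelsSet A r Φ ↔ P A r)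

/-- `P` is a first-order property of ARSs (definable by a single sentence). -/
def IsFOP (P : ∀ A : Type, (A → A → Prop) → Prop) : Prop :=
  ∃ φ : FirstOrder.Language.order.Sentence,
    ∀ (A : Type), Nonempty A → ∀ r : A → A → Prop,
      (@FirstOrder.Language.Sentence.Realize FirstOrder.Language.order A (arsStructure A r) φ
        ↔ P A r)

/-! Decreasing diagrams. -/

/-- Union of the relations with labels below `α`. -/
def Below {A : Type} {I : Type*} (lt : I → I → Prop) (f : I → A → A → Prop) (α : I) :
    A → A → Prop :=
  fun x y => ∃ γ, lt γ α ∧ f γ x y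

/-- Every peak `c ←_β a →_α b` joins by a decreasing elementary diagram. -/
def LocallyDecreasing {A : Type} {I : Type*} (lt : I → I → Prop) (f : I → A → A → Prop) : Prop :=
  ∀ α β a b c, f α a b → f β a c →
    ∃ b' b'' c' c'' d,
      Relation.ReflTransGen (Below lt f α) b b' ∧
      (f β b' b'' ∨ b' = b'') ∧
      Relation.ReflTransGen (fun x y => Below lt f α x y ∨ Below lt f β x y) b'' d ∧
      Relation.ReflTransGen (Below lt f β) c c' ∧
      (f α c' c'' ∨ c' = c'') ∧
      Relation.ReflTransGen (fun x y => Below lt f α x y ∨ Below lt f β x y) c'' d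

/-- Decreasing Church–Rosser with label set the ordinals below `α`. -/
def DCRord (α : Ordinal.{0}) {A : Type} (r : A → A → Prop) : Prop :=
  ∃ f : {β : Ordinal // β < α} → A → A → Prop,
    (∀ x y, r x y ↔ ∃ i, f i x y) ∧
    LocallyDecreasing (fun i j => i.val < j.val) f

/-- Decreasing Church–Rosser (for some ordinal label set). -/
def DCR {A : Type} (r : A → A → Prop) : Prop := ∃ α, DCRord α r

/-- Decreasing commutation: every peak `c ←_β a ⇝_α b` joins decreasingly. -/
def DCommuting {A : Type} {I : Type*} (lt : I → I → Prop) (f g : I → A → A → Prop) : Prop :=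
  ∀ α β a b c, g α a b → f β a c →
    ∃ b' b'' c' c'' d,
      Relation.ReflTransGen (Below lt f α) b b' ∧
      (f β b' b'' ∨ b' = b'') ∧
      Relation.ReflTransGen (fun x y => Below lt f α x y ∨ Below lt f β x y) b'' d ∧
      Relation.ReflTransGen (Below lt g β) c c' ∧
      (g α c' c'' ∨ c' = c'') ∧
      Relation.ReflTransGen (fun x y => Below lt g α x y ∨ Below lt g β x y) c'' d

/-- Decreasing commutation with label set the ordinals below `α` (the class `DC_α`). -/
def DCord (α : Ordinal.{0}) {A : Type} (r s : A → A → Prop) : Prop :=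
  ∃ f g : {β : Ordinal // β < α} → A → A → Prop,
    (∀ x y, r x y ↔ ∃ i, f i x y) ∧
    (∀ x y, s x y ↔ ∃ i, g i x y) ∧
    DCommuting (fun i j => i.val < j.val) f g

/-- The nodes of a ladder: the rungs, with two side nodes between consecutive rungs. -/
inductive Ladder where
  | rung (i : ℕ)
  | side (t : Bool) (i : ℕ)

namespace Ladder

/-- The two labelled step relations on a ladder, one for each `t`. From rung `i + 1` one descends
to rung `i` through the side node `side t i`; the opposite side node drops to rung `0`. -/
inductive Step (t : Bool) : ℕ → Ladder → Ladder → Prop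
  | out (i : ℕ) : Step t i (rung (i + 1)) (side t i)
  | back (i : ℕ) : Step t i (side t i) (rung i)
  | drop (i : ℕ) : Step t i (side (!t) i) (rung 0)

/-- Steps of the ladder cut off at height `N`. -/
def StepBelow (N : ℕ) (t : Bool) (x y : Ladder) : Prop := ∃ i < N, Step t i x y

/-- Every step of the ladder is labelled by its height. -/
def heightLabel (α : Ordinal.{0}) (t : Bool) (i : {β : Ordinal // β < α}) (x y : Ladder) : Prop :=
  ∃ k : ℕ, i.val = k ∧ Step t k x y

theorem exists_surjective_nat : ∃ h : ℕ → Ladder, Function.Surjective h := by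
  refine ⟨fun n => if n % 3 = 0 then rung (n / 3) else side (n % 3 = 1) (n / 3), ?_⟩
  rintro (i | ⟨_ | _, i⟩)
  · exact ⟨3 * i, by simp⟩
  · exact ⟨3 * i + 2, by simp [Nat.add_mod, Nat.mul_add_div]⟩
  · exact ⟨3 * i + 1, by simp [Nat.add_mod, Nat.mul_add_div]⟩

theorem heightLabel_descends {α : Ordinal.{0}} (t : Bool) (j : {β : Ordinal // β < α}) :
    ∀ i : ℕ, (i : Ordinal) ≤ j.val →
      ReflTransGen (Below (fun i j => i.val < j.val) (heightLabel α t) j) (rung i) (rung 0)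
  | 0, _ => .refl
  | i + 1, h => by
    have hi : (i : Ordinal) < j.val := lt_of_lt_of_le (by exact_mod_cast Nat.lt_succ_self i) h
    exact .head ⟨⟨i, hi.trans j.2⟩, hi, i, rfl, .out i⟩
      (.head ⟨⟨i, hi.trans j.2⟩, hi, i, rfl, .back i⟩ (heightLabel_descends t j i hi.le))

theorem dCommuting_heightLabel (α : Ordinal.{0}) :
    DCommuting (fun i j => i.val < j.val) (heightLabel α true) (heightLabel α false) := by
  rintro i j a b c ⟨k, hi, hg⟩ ⟨l, hj, hf⟩
  cases hg with
  | out =>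
    cases hf
    exact ⟨_, rung 0, _, rung 0, rung 0, .refl, .inl ⟨k, hj, .drop k⟩, .refl, .refl,
      .inl ⟨k, hi, .drop k⟩, .refl⟩
  | back =>
    cases hf
    exact ⟨rung 0, rung 0, rung 0, rung 0, rung 0, heightLabel_descends _ _ _ hi.ge, .inr rfl,
      .refl, .refl, .inr rfl, .refl⟩
  | drop =>
    cases hf
    exact ⟨rung 0, rung 0, rung 0, rung 0, rung 0, .refl, .inr rfl, .refl,
      heightLabel_descends _ _ _ hj.ge, .inr rfl, .refl⟩

theorem dCord_stepBelow (N : ℕ) : DCord N (StepBelow N true) (StepBelow N false) := by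
  have key (t : Bool) (x y : Ladder) : StepBelow N t x y ↔ ∃ i, heightLabel N t i x y := by
    constructor
    · rintro ⟨k, hk, h⟩
      exact ⟨⟨k, by exact_mod_cast hk⟩, k, rfl, h⟩
    · rintro ⟨⟨_, hi⟩, k, rfl, h⟩
      exact ⟨k, by exact_mod_cast hi, h⟩
  exact ⟨_, _, key true, key false, dCommuting_heightLabel _⟩

end Ladder

theorem DCommuting.symm {A : Type} {I : Type*} {lt : I → I → Prop} {f g : I → A → A → Prop}
    (h : DCommuting lt f g) : DCommuting lt g f := by
  intro i j a b c hf hg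
  obtain ⟨b', b'', c', c'', d, h₁, h₂, h₃, h₄, h₅, h₆⟩ := h j i a c b hg hf
  exact ⟨c', c'', b', b'', d, h₄, h₅, ReflTransGen.mono (fun _ _ => Or.symm) _ _ h₆, h₁, h₂,
    ReflTransGen.mono (fun _ _ => Or.symm) _ _ h₃⟩

namespace Ladder

variable {t : Bool} {k i : ℕ} {y : Ladder}

theorem Step.eq_of_rung_succ (h : Step t k (rung (i + 1)) y) : y = side t i := by
  cases h; rfl

theorem not_step_rung_zero : ¬ Step t k (rung 0) y := nofun

theorem Step.eq_of_side (h : Step t k (side t i) y) : y = rung i := by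
  generalize ht : side t i = x at h
  cases h <;> simp_all

theorem Step.eq_of_side_not (h : Step t k (side (!t) i) y) : y = rung 0 := by
  generalize ht : side (!t) i = x at h
  cases h <;> simp_all

variable {α : Ordinal.{0}} {f g : {β : Ordinal // β < α} → Ladder → Ladder → Prop}

/-- Steps of `f` whose label can be chosen below `k`. -/
def LowStep (f : {β : Ordinal // β < α} → Ladder → Ladder → Prop) (k : ℕ) (x y : Ladder) : Prop :=
  ∃ i, i.val < (k : Ordinal) ∧ f i x y

/-- All steps labelled by `f` are steps of the ladder in direction `t`. -/
def StepLabelling (t : Bool) (f : {β : Ordinal // β < α} → Ladder → Ladder → Prop) : Prop :=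
  ∀ i x y, f i x y → ∃ k, Step t k x y

theorem StepLabelling.lowStep (hf : StepLabelling t f) {x : Ladder} (h : LowStep f k x y) :
    ∃ k, Step t k x y :=
  let ⟨_, _, h⟩ := h; hf _ _ _ h

theorem eq_of_reflTransGen_rung_zero {r : Ladder → Ladder → Prop}
    (hr : ∀ x y, r x y → ∃ k, Step t k x y) (h : ReflTransGen r (rung 0) y) : y = rung 0 := by
  rcases h.cases_head with h | ⟨_, h, -⟩
  · exact h.symm
  · exact absurd (hr _ _ h).choose_spec not_step_rung_zero

/-- From a side node of the opposite direction one can only drop to rung `0`. -/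
theorem eq_or_drop {r : Ladder → Ladder → Prop} (hr : ∀ x y, r x y → ∃ k, Step t k x y)
    (h : ReflTransGen r (side (!t) i) y) :
    y = side (!t) i ∨ y = rung 0 ∧ r (side (!t) i) (rung 0) := by
  rcases h.cases_head with h | ⟨z, h, hz⟩
  · exact .inl h.symm
  · obtain ⟨k, hk⟩ := hr _ _ h
    obtain rfl := hk.eq_of_side_not
    exact .inr ⟨eq_of_reflTransGen_rung_zero hr hz, h⟩

/-- A descent from rung `i + 1` passes through `side t i` and rung `i`. -/
theorem descent_succ {r : Ladder → Ladder → Prop} (hr : ∀ x y, r x y → ∃ k, Step t k x y)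
    (h : ReflTransGen r (rung (i + 1)) (rung 0)) :
    r (rung (i + 1)) (side t i) ∧ r (side t i) (rung i) ∧ ReflTransGen r (rung i) (rung 0) := by
  rcases h.cases_head with h | ⟨z, h₁, h⟩
  · cases h
  obtain ⟨_, hk⟩ := hr _ _ h₁
  obtain rfl := hk.eq_of_rung_succ
  rcases h.cases_head with h | ⟨z, h₂, h⟩
  · cases h
  obtain ⟨_, hk⟩ := hr _ _ h₂
  obtain rfl := hk.eq_of_side
  exact ⟨h₁, h₂, h⟩

theorem below_stepLabelling (hf : StepLabelling t f) (i : {β : Ordinal // β < α}) (x y : Ladder)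
    (h : Below (fun i j => i.val < j.val) f i x y) : ∃ k, Step t k x y :=
  let ⟨_, _, h⟩ := h; hf _ _ _ h

theorem below_or_stepLabelling (hf : StepLabelling t f) (i j : {β : Ordinal // β < α})
    (x y : Ladder) (h : Below (fun i j => i.val < j.val) f i x y ∨
      Below (fun i j => i.val < j.val) f j x y) : ∃ k, Step t k x y :=
  h.elim (below_stepLabelling hf i x y) (below_stepLabelling hf j x y)

theorem lowStep_of_below {a : {β : Ordinal // β < α}} (ha : a.val < ((k + 1 : ℕ) : Ordinal))
    (x y : Ladder) (h : Below (fun i j => i.val < j.val) f a x y) : LowStep f k x y := by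
  obtain ⟨c, hc, h⟩ := h
  exact ⟨c, lt_of_lt_of_le hc (by push_cast at ha; exact Order.lt_add_one_iff.1 ha), h⟩

theorem lowStep_of_below_or {a b : {β : Ordinal // β < α}}
    (ha : a.val < ((k + 1 : ℕ) : Ordinal)) (hb : b.val < ((k + 1 : ℕ) : Ordinal))
    (x y : Ladder) (h : Below (fun i j => i.val < j.val) f a x y ∨
      Below (fun i j => i.val < j.val) f b x y) : LowStep f k x y :=
  h.elim (lowStep_of_below ha x y) (lowStep_of_below hb x y)

theorem LowStep.lt_succ {a : {β : Ordinal // β < α}} (ha : a.val < (k : Ordinal)) :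
    a.val < ((k + 1 : ℕ) : Ordinal) :=
  ha.trans (by exact_mod_cast Nat.lt_succ_self k)

/-- The peak at rung `i + 1` bounds the label of a drop from `side t i`. -/
theorem exists_drop (hf : StepLabelling t f) (hg : StepLabelling (!t) g)
    (h : DCommuting (fun i j => i.val < j.val) f g) {a b : {β : Ordinal // β < α}}
    (ha : a.val < ((k + 1 : ℕ) : Ordinal)) (hb : b.val < ((k + 1 : ℕ) : Ordinal))
    (hga : g a (rung (i + 1)) (side (!t) i)) (hfb : f b (rung (i + 1)) (side t i)) :
    ∃ c, (c = a ∨ c.val < (k : Ordinal)) ∧ g c (side t i) (rung 0) := by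
  obtain ⟨b', b'', c', c'', d, h₁, h₂, h₃, h₄, h₅, h₆⟩ := h _ _ _ _ _ hga hfb
  have hd₁ : d = side (!t) i ∨ d = rung 0 := by
    have h' : ReflTransGen (fun x y => ∃ k, Step t k x y) (side (!t) i) d :=
      (ReflTransGen.mono (below_stepLabelling hf _) _ _ h₁).trans
        (.trans (h₂.elim (fun h => .single (hf _ _ _ h)) (fun h => h ▸ .refl))
          (ReflTransGen.mono (below_or_stepLabelling hf _ _) _ _ h₃))
    exact (eq_or_drop (fun _ _ h => h) h').imp_right And.left
  have h' : ReflTransGen (fun x y => ∃ c, (c = a ∨ c.val < (k : Ordinal)) ∧ g c x y)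
      (side t i) d := by
    refine (ReflTransGen.mono (fun x y h => ?_) _ _ h₄).trans
      (.trans (h₅.elim (fun h => .single ⟨a, .inl rfl, h⟩) (fun h => h ▸ .refl))
        (ReflTransGen.mono (fun x y h => ?_) _ _ h₆))
    · obtain ⟨c, hc, h⟩ := lowStep_of_below hb _ _ h
      exact ⟨c, .inr hc, h⟩
    · obtain ⟨c, hc, h⟩ := lowStep_of_below_or ha hb _ _ h
      exact ⟨c, .inr hc, h⟩
  have hr : ∀ x y, (∃ c, (c = a ∨ c.val < (k : Ordinal)) ∧ g c x y) → ∃ k, Step (!t) k x y :=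
    fun x y ⟨_, _, h⟩ => hg _ _ _ h
  rw [← Bool.not_not t] at h' ⊢
  rcases eq_or_drop hr h' with h' | h'
  · rcases hd₁ with hd | hd <;> simp [hd] at h'
  · exact h'.2

/-- The peaks at rung `i + 1` and `side t i` force a descent from rung `i` in which all steps but
one have labels below `k`, and the label of that exceptional step is controlled. -/
theorem exists_descent (hf : StepLabelling t f) (hg : StepLabelling (!t) g)
    (h : DCommuting (fun i j => i.val < j.val) f g) {a : {β : Ordinal // β < α}}
    (ha : a.val < ((k + 1 : ℕ) : Ordinal)) (hga : g a (rung (i + 1)) (side (!t) i))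
    (hf₁ : LowStep f (k + 1) (rung (i + 1)) (side t i))
    (hf₂ : LowStep f (k + 1) (side t i) (rung i)) :
    ∃ c u v, (c = a ∨ c.val < (k : Ordinal)) ∧ ReflTransGen (LowStep g k) (rung i) u ∧
      (g c u v ∨ u = v) ∧ ReflTransGen (LowStep g k) v (rung 0) := by
  obtain ⟨b, hb, hfb⟩ := hf₁
  obtain ⟨b', hb', hfb'⟩ := hf₂
  obtain ⟨c, hc, hgc⟩ := exists_drop hf hg h ha hb hga hfb
  have hck : c.val < ((k + 1 : ℕ) : Ordinal) := hc.elim (fun h => h ▸ ha) LowStep.lt_succ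
  obtain ⟨x, y, u, v, d, h₁, h₂, h₃, h₄, h₅, h₆⟩ := h _ _ _ _ _ hgc hfb'
  have hd : ReflTransGen (fun x y => ∃ k, Step t k x y) (rung 0) d :=
    (ReflTransGen.mono (below_stepLabelling hf _) _ _ h₁).trans
      (.trans (h₂.elim (fun h => .single (hf _ _ _ h)) (fun h => h ▸ .refl))
        (ReflTransGen.mono (below_or_stepLabelling hf _ _) _ _ h₃))
  obtain rfl := eq_of_reflTransGen_rung_zero (fun _ _ h => h) hd
  exact ⟨c, u, v, hc, ReflTransGen.mono (lowStep_of_below hb') _ _ h₄, h₅,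
    ReflTransGen.mono (lowStep_of_below_or hck hb') _ _ h₆⟩

/-- Going two rungs down, the labels needed for a descent decrease. -/
theorem descent_low (hf : StepLabelling t f) (hg : StepLabelling (!t) g)
    (h : DCommuting (fun i j => i.val < j.val) f g)
    (hfd : ReflTransGen (LowStep f (k + 1)) (rung (i + 2)) (rung 0))
    (hgd : ReflTransGen (LowStep g (k + 1)) (rung (i + 2)) (rung 0)) :
    ReflTransGen (LowStep g k) (rung i) (rung 0) := by
  obtain ⟨hf₁, hf₂, hfd⟩ := descent_succ (fun _ _ => hf.lowStep) hfd
  obtain ⟨⟨a, ha, hga⟩, -, -⟩ := descent_succ (fun _ _ => hg.lowStep) hgd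
  obtain ⟨hf₃, hf₄, -⟩ := descent_succ (fun _ _ => hf.lowStep) hfd
  by_cases hlow : LowStep g k (rung (i + 1)) (side (!t) i)
  · obtain ⟨a, ha, hga⟩ := hlow
    obtain ⟨c, u, v, hc, h₁, h₂, h₃⟩ := exists_descent hf hg h (LowStep.lt_succ ha) hga hf₃ hf₄
    have hck : c.val < (k : Ordinal) := hc.elim (fun h => h ▸ ha) id
    exact h₁.trans (.trans (h₂.elim (fun h => .single ⟨c, hck, h⟩) (fun h => h ▸ .refl)) h₃)
  · have hno : ¬ ReflTransGen (LowStep g k) (rung (i + 1)) (rung 0) := fun h =>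
      hlow (descent_succ (fun _ _ => hg.lowStep) h).1
    obtain ⟨c, u, v, -, h₁, h₂, h₃⟩ := exists_descent hf hg h ha hga hf₁ hf₂
    rcases h₁.cases_head with rfl | ⟨z, hz, -⟩
    · rcases h₂ with h₂ | rfl
      · obtain ⟨_, hs⟩ := hg _ _ _ h₂
        obtain rfl := hs.eq_of_rung_succ
        rcases h₃.cases_head with h₃ | ⟨z, hz, h₃⟩
        · cases h₃
        · obtain ⟨_, hs⟩ := hg.lowStep hz
          obtain rfl := hs.eq_of_side
          exact h₃
      · exact absurd h₃ hno
    · obtain ⟨_, hs⟩ := hg.lowStep hz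
      obtain rfl := hs.eq_of_rung_succ
      exact absurd hz hlow

/-- Labels below `k` do not suffice to descend from a rung above `2 * k`. -/
theorem not_descent (hf : StepLabelling true f) (hg : StepLabelling false g)
    (h : DCommuting (fun i j => i.val < j.val) f g) (k i : ℕ) :
    ReflTransGen (LowStep f k) (rung (i + 1 + 2 * k)) (rung 0) →
      ¬ ReflTransGen (LowStep g k) (rung (i + 1 + 2 * k)) (rung 0) := by
  induction k with
  | zero =>
    intro hfd
    obtain ⟨⟨_, h, _⟩, -⟩ := descent_succ (fun _ _ => hf.lowStep) hfd
    simp at h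
  | succ k ih =>
    exact fun hfd hgd => ih (descent_low (t := false) hg hf h.symm hgd hfd)
      (descent_low (t := true) hf hg h hfd hgd)

theorem descent_stepBelow (N : ℕ) (t : Bool) :
    ∀ i ≤ N, ReflTransGen (StepBelow N t) (rung i) (rung 0)
  | 0, _ => .refl
  | i + 1, h => .head ⟨i, h, .out i⟩ (.head ⟨i, h, .back i⟩
      (descent_stepBelow N t i (Nat.le_of_succ_le h)))

theorem not_dCord_stepBelow {n N : ℕ} (hN : 2 * n < N) :
    ¬ DCord n (StepBelow N true) (StepBelow N false) := by
  rintro ⟨f, g, hf, hg, h⟩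
  obtain ⟨i, rfl⟩ : ∃ i, N = i + 1 + 2 * n := ⟨N - 2 * n - 1, by omega⟩
  have key {t : Bool} {f : {β : Ordinal // β < (n : Ordinal)} → Ladder → Ladder → Prop}
      (hf : ∀ x y, StepBelow (i + 1 + 2 * n) t x y ↔ ∃ i, f i x y) :
      StepLabelling t f ∧ ReflTransGen (LowStep f n) (rung (i + 1 + 2 * n)) (rung 0) := by
    refine ⟨fun j x y hj => ?_, ReflTransGen.mono (fun x y hxy => ?_) _ _
      (descent_stepBelow _ t _ le_rfl)⟩
    · obtain ⟨k, -, hk⟩ := (hf x y).2 ⟨j, hj⟩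
      exact ⟨k, hk⟩
    · obtain ⟨j, hj⟩ := (hf x y).1 hxy
      exact ⟨j, j.2, hj⟩
  exact not_descent (key hf).1 (key hg).1 h n i (key hf).2 (key hg).2

end Ladder

/-- for every `n`, some countable two-relation ARS is in `DC_{5n+1}`
but not in `DC_n`. -/
theorem stmt16 (n : ℕ) :
    ∃ (A : Type) (r s : A → A → Prop),
      Nonempty A ∧ (∃ h : ℕ → A, Function.Surjective h) ∧
      DCord ((5 * n + 1 : ℕ) : Ordinal) r s ∧ ¬ DCord (n : Ordinal) r s := by
  exact ⟨Ladder, Ladder.StepBelow (5 * n + 1) true, Ladder.StepBelow (5 * n + 1) false,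
    ⟨.rung 0⟩, Ladder.exists_surjective_nat, Ladder.dCord_stepBelow _,
    Ladder.not_dCord_stepBelow (by omega)⟩
end

section
/- Let α be an ordinal. If there exists an ARS with two relations that belongs to DC_{α+1} but not to DC_α, then for every ordinal β < α there exists an ARS with two relations that belongs to DC_α but not to DC_β. Moreover, the same implication holds with all the ARSs restricted to countable ones. -/
open Relation Function FirstOrder

namespace DecHier

/-- Families of labelled steps for the two relations `→` (index `false`) and `⇝` (index `true`). -/
abbrev Lbl (V : Type) := Bool → Ordinal.{0} → V → V → Prop

/-- The unlabelled relation underlying one of the two families. -/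
def Under {V : Type} (E : Lbl V) (t : Bool) (x y : V) : Prop := ∃ i, E t i x y

/-- One side of a decreasing elementary diagram. -/
def Arm {V : Type} (F : Lbl V) (t : Bool) (α β : Ordinal.{0}) (b d : V) : Prop :=
  ∃ b' b'', ReflTransGen (fun x y => ∃ γ, γ < α ∧ F t γ x y) b b' ∧
    (F t β b' b'' ∨ b' = b'') ∧
    ReflTransGen (fun x y => ∃ γ, (γ < α ∨ γ < β) ∧ F t γ x y) b'' d

/-- A decreasing completion of a peak. -/
def Join {V : Type} (F : Lbl V) (t : Bool) (α β : Ordinal.{0}) (b c : V) : Prop :=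
  ∃ d, Arm F (!t) α β b d ∧ Arm F t β α c d

/-- Decreasing commutation of labelled families. -/
def Dec {V : Type} (F : Lbl V) : Prop :=
  ∀ t α β a b c, F t α a b → F (!t) β a c → Join F t α β b c

theorem rtg_mono {V : Type*} {r r' : V → V → Prop} {x y : V} (h : ReflTransGen r x y)
    (hr : ∀ x y, r x y → r' x y) : ReflTransGen r' x y := ReflTransGen.mono hr _ _ h

section basic

variable {V : Type} {F : Lbl V} {t : Bool} {α β : Ordinal.{0}} {b c d : V}

theorem Join.symm (h : Join F t α β b c) : Join F (!t) β α c b := by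
  obtain ⟨d, h₁, h₂⟩ := h
  exact ⟨d, by simpa using h₂, h₁⟩

theorem Dec.of_true
    (h : ∀ α β a b c, F true α a b → F false β a c → Join F true α β b c) : Dec F := by
  intro t α β a b c h₁ h₂
  cases t
  · exact (h _ _ _ _ _ h₂ h₁).symm
  · exact h _ _ _ _ _ h₁ h₂

theorem Arm.refl : Arm F t α β b b := ⟨b, b, .refl, .inr rfl, .refl⟩

theorem Arm.one (h : F t β b d) : Arm F t α β b d := ⟨b, d, .refl, .inl h, .refl⟩

theorem Arm.path (h : ReflTransGen (fun x y => ∃ γ, γ < α ∧ F t γ x y) b d) :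
    Arm F t α β b d := ⟨d, d, h, .inr rfl, .refl⟩

theorem Arm.path_right (h : ReflTransGen (fun x y => ∃ γ, γ < β ∧ F t γ x y) b d) :
    Arm F t α β b d :=
  ⟨b, b, .refl, .inr rfl, rtg_mono h fun _ _ ⟨γ, hγ, h⟩ => ⟨γ, .inr hγ, h⟩⟩

theorem Arm.one_path (h : F t β b c)
    (h' : ReflTransGen (fun x y => ∃ γ, (γ < α ∨ γ < β) ∧ F t γ x y) c d) :
    Arm F t α β b d := ⟨b, c, .refl, .inl h, h'⟩

end basic

section bridge

variable {A : Type} {δ : Ordinal.{0}} {r s : A → A → Prop}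

theorem exists_dec_of_DCord (h : DCord δ r s) :
    ∃ F : Lbl A, Dec F ∧ (∀ x y, Under F false x y ↔ r x y) ∧ (∀ x y, Under F true x y ↔ s x y) ∧
      ∀ t i x y, F t i x y → i < δ := by
  obtain ⟨f, g, hf, hg, hd⟩ := h
  refine ⟨fun t i x y => ∃ h : i < δ, (bif t then g else f) ⟨i, h⟩ x y, Dec.of_true ?_, ?_, ?_, ?_⟩
  · rintro α β a b c ⟨hα, h₁⟩ ⟨hβ, h₂⟩
    obtain ⟨b', b'', c', c'', d, h₃, h₄, h₅, h₆, h₇, h₈⟩ := hd ⟨α, hα⟩ ⟨β, hβ⟩ a b c h₁ h₂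
    refine ⟨d, ⟨b', b'', rtg_mono h₃ ?_, h₄.imp_left fun h => ⟨hβ, h⟩, rtg_mono h₅ ?_⟩,
      ⟨c', c'', rtg_mono h₆ ?_, h₇.imp_left fun h => ⟨hα, h⟩, rtg_mono h₈ ?_⟩⟩
    · rintro x y ⟨γ, hγ, h⟩
      exact ⟨γ, hγ, γ.2, h⟩
    · rintro x y (⟨γ, hγ, h⟩ | ⟨γ, hγ, h⟩)
      · exact ⟨γ, .inl hγ, γ.2, h⟩
      · exact ⟨γ, .inr hγ, γ.2, h⟩
    · rintro x y ⟨γ, hγ, h⟩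
      exact ⟨γ, hγ, γ.2, h⟩
    · rintro x y (⟨γ, hγ, h⟩ | ⟨γ, hγ, h⟩)
      · exact ⟨γ, .inr hγ, γ.2, h⟩
      · exact ⟨γ, .inl hγ, γ.2, h⟩
  · intro x y
    rw [hf]
    exact ⟨fun ⟨i, hi, h⟩ => ⟨⟨i, hi⟩, h⟩, fun ⟨i, h⟩ => ⟨i, i.2, h⟩⟩
  · intro x y
    rw [hg]
    exact ⟨fun ⟨i, hi, h⟩ => ⟨⟨i, hi⟩, h⟩, fun ⟨i, h⟩ => ⟨i, i.2, h⟩⟩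
  · rintro t i x y ⟨hi, -⟩
    exact hi

theorem DCord_of_dec {F : Lbl A} (hF : Dec F) (hr : ∀ x y, Under F false x y ↔ r x y)
    (hs : ∀ x y, Under F true x y ↔ s x y) (hδ : ∀ t i x y, F t i x y → i < δ) : DCord δ r s := by
  refine ⟨fun i => F false i, fun i => F true i, ?_, ?_, ?_⟩
  · intro x y
    rw [← hr]
    exact ⟨fun ⟨i, h⟩ => ⟨⟨i, hδ _ _ _ _ h⟩, h⟩, fun ⟨i, h⟩ => ⟨i, h⟩⟩
  · intro x y
    rw [← hs]
    exact ⟨fun ⟨i, h⟩ => ⟨⟨i, hδ _ _ _ _ h⟩, h⟩, fun ⟨i, h⟩ => ⟨i, h⟩⟩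
  · rintro ⟨α, hα⟩ ⟨β, hβ⟩ a b c h₁ h₂
    obtain ⟨d, ⟨b', b'', h₃, h₄, h₅⟩, ⟨c', c'', h₆, h₇, h₈⟩⟩ := hF true α β a b c h₁ h₂
    refine ⟨b', b'', c', c'', d, rtg_mono h₃ ?_, h₄, rtg_mono h₅ ?_, rtg_mono h₆ ?_, h₇,
      rtg_mono h₈ ?_⟩
    · rintro x y ⟨γ, hγ, h⟩
      exact ⟨⟨γ, hδ _ _ _ _ h⟩, hγ, h⟩
    · rintro x y ⟨γ, hγ, h⟩
      exact hγ.imp (fun hγ => ⟨⟨γ, hδ _ _ _ _ h⟩, hγ, h⟩) fun hγ => ⟨⟨γ, hδ _ _ _ _ h⟩, hγ, h⟩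
    · rintro x y ⟨γ, hγ, h⟩
      exact ⟨⟨γ, hδ _ _ _ _ h⟩, hγ, h⟩
    · rintro x y ⟨γ, hγ, h⟩
      exact hγ.symm.imp (fun hγ => ⟨⟨γ, hδ _ _ _ _ h⟩, hγ, h⟩)
        fun hγ => ⟨⟨γ, hδ _ _ _ _ h⟩, hγ, h⟩

theorem DCord_mono {δ' : Ordinal.{0}} (hle : δ ≤ δ') (h : DCord δ r s) : DCord δ' r s := by
  obtain ⟨F, hF, hr, hs, hδ⟩ := exists_dec_of_DCord h
  exact DCord_of_dec hF hr hs fun t i x y h => (hδ t i x y h).trans_le hle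

end bridge

/-- Steps with label at most `M`, of which at most one has label `M` itself: the Boolean
component records whether that step has been used up. -/
def Ph {V : Type} (F : Lbl V) (t : Bool) (M : Ordinal.{0}) (p q : V × Bool) : Prop :=
  (p.2 = q.2 ∧ ∃ i, i < M ∧ F t i p.1 q.1) ∨
    (p.2 = false ∧ q.2 = true ∧ ∃ i, i ≤ M ∧ F t i p.1 q.1)

/-- The step from `x` to `y` has a label at most `M`, below `M` if `φ` holds. -/
def Bd {V : Type} (F : Lbl V) (t : Bool) (M : Ordinal.{0}) (φ : Bool) (x y : V) : Prop :=
  ∃ i, F t i x y ∧ i ≤ M ∧ (φ = true → i < M)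

section phases

variable {V : Type} {F : Lbl V} {t : Bool} {M : Ordinal.{0}} {φ ψ : Bool}

theorem Ph.bd {p q : V × Bool} (h : Ph F t M p q) : Bd F t M p.2 p.1 q.1 := by
  rcases h with ⟨-, i, hi, h⟩ | ⟨h₁, -, i, hi, h⟩
  · exact ⟨i, h, hi.le, fun _ => hi⟩
  · exact ⟨i, h, hi, fun h₂ => by simp [h₁] at h₂⟩

theorem Ph.under {p q : V × Bool} (h : Ph F t M p q) : Under F t p.1 q.1 :=
  let ⟨i, h, _⟩ := h.bd; ⟨i, h⟩

theorem Ph.of_true {x y : V} {k : Bool} (h : Ph F t M (x, true) (y, k)) :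
    k = true ∧ Bd F t M true x y := by
  rcases h with ⟨h₁, i, hi, h⟩ | ⟨h₁, -⟩
  · exact ⟨h₁.symm, i, h, hi.le, fun _ => hi⟩
  · simp at h₁

theorem Ph.to_false {x y : V} {k : Bool} (h : Ph F t M (x, k) (y, false)) :
    k = false ∧ Bd F t M true x y := by
  rcases h with ⟨h₁, i, hi, h⟩ | ⟨-, h₁, -⟩
  · exact ⟨h₁, i, h, hi.le, fun _ => hi⟩
  · simp at h₁

theorem Bd.weaken {x y : V} (h : Bd F t M φ x y) : Bd F t M false x y :=
  let ⟨i, h, hi, _⟩ := h; ⟨i, h, hi, by simp⟩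

theorem Bd.of_true {x y : V} (h : Bd F t M true x y) : Bd F t M φ x y :=
  let ⟨i, h, hi, h'⟩ := h; ⟨i, h, hi, fun _ => h' rfl⟩

theorem ph_path_weaken {x y : V} {k : Bool} (h : ReflTransGen (Ph F t M) (x, true) (y, k)) :
    ReflTransGen (Ph F t M) (x, false) (y, false) := by
  suffices H : ∀ p q : V × Bool, ReflTransGen (Ph F t M) p q → p.2 = true →
      q.2 = true ∧ ReflTransGen (Ph F t M) (p.1, false) (q.1, false) from (H _ _ h rfl).2
  intro p q h hp
  induction h with
  | refl => exact ⟨hp, .refl⟩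
  | tail _ h ih =>
    rcases h with ⟨h₁, i, hi, h⟩ | ⟨h₁, -⟩
    · exact ⟨h₁ ▸ ih.1, ih.2.tail (.inl ⟨rfl, i, hi, h⟩)⟩
    · simp [h₁] at ih

theorem ph_path_of_strict {x y : V} {k : Bool}
    (h : ReflTransGen (fun x y => ∃ γ, γ < M ∧ F t γ x y) x y) :
    ReflTransGen (Ph F t M) (x, k) (y, k) :=
  h.lift (fun v => (v, k)) fun _ _ ⟨γ, hγ, h⟩ => .inl ⟨rfl, γ, hγ, h⟩

theorem ph_path_under {p q : V × Bool} (h : ReflTransGen (Ph F t M) p q) :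
    ReflTransGen (Under F t) p.1 q.1 := h.lift Prod.fst fun _ _ h => h.under

theorem Arm.ph {α β : Ordinal.{0}} {b d : V} (h : Arm F t α β b d) (hα : α ≤ M) (hβ : β ≤ M)
    (hφ : φ = true → β < M) : ∃ k, ReflTransGen (Ph F t M) (b, φ) (d, k) := by
  obtain ⟨b', b'', h₁, h₂, h₃⟩ := h
  have H₁ : ReflTransGen (Ph F t M) (b, φ) (b', φ) :=
    ph_path_of_strict (rtg_mono h₁ fun _ _ ⟨γ, hγ, h⟩ => ⟨γ, hγ.trans_le hα, h⟩)
  have H₃ : ∀ k, ReflTransGen (Ph F t M) (b'', k) (d, k) := fun k =>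
    ph_path_of_strict (rtg_mono h₃ fun _ _ ⟨γ, hγ, h⟩ =>
      ⟨γ, hγ.elim (fun h => h.trans_le hα) fun h => h.trans_le hβ, h⟩)
  rcases h₂ with h₂ | rfl
  · cases φ
    · have : Ph F t M (b', false) (b'', true) := .inr ⟨rfl, rfl, β, hβ, h₂⟩
      exact ⟨true, (H₁.tail this).trans (H₃ _)⟩
    · have : Ph F t M (b', true) (b'', true) := .inl ⟨rfl, β, hφ rfl, h₂⟩
      exact ⟨true, (H₁.tail this).trans (H₃ _)⟩
  · exact ⟨φ, H₁.trans (H₃ _)⟩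

/-- Every peak of a decreasing family with labels bounded by `M` joins by bounded paths. -/
theorem Dec.ph {a b c : V} (hF : Dec F) (hb : Bd F t M φ a b) (hc : Bd F (!t) M ψ a c) :
    ∃ d k k', ReflTransGen (Ph F t M) (c, φ) (d, k) ∧
      ReflTransGen (Ph F (!t) M) (b, ψ) (d, k') := by
  obtain ⟨α, h₁, hα, hφ⟩ := hb
  obtain ⟨β, h₂, hβ, hψ⟩ := hc
  obtain ⟨d, h₃, h₄⟩ := hF t α β a b c h₁ h₂
  obtain ⟨k, hk⟩ := h₄.ph hβ hα hφ
  obtain ⟨k', hk'⟩ := h₃.ph hα hβ hψ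
  exact ⟨d, k, k', hk, hk'⟩

end phases

/-- `E` is a full subsystem of `E'` along `ι`, where a step of type `t` leaving it leads into
the set `O t`, which is closed under steps of type `t`. -/
structure Emb {V V' : Type} (E : Lbl V) (E' : Lbl V') (ι : V → V') (O : Bool → V' → Prop) :
    Prop where
  inj : Injective ι
  step : ∀ t x z, Under E' t (ι x) z → (∃ y, z = ι y ∧ Under E t x y) ∨ O t z
  lift : ∀ t x y, Under E t x y → Under E' t (ι x) (ι y)
  closed : ∀ t z z', O t z → Under E' t z z' → O t z'
  notMem : ∀ t x, ¬ O t (ι x)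
  disj : ∀ z, O true z → ¬ O false z

theorem path_stay {V V' : Type} {R : V → V → Prop} {R' : V' → V' → Prop} {ι : V → V'}
    {O : V' → Prop} (hstep : ∀ x z, R' (ι x) z → (∃ y, z = ι y ∧ R x y) ∨ O z)
    (hO : ∀ z z', O z → R' z z' → O z') {x : V} {z : V'} (h : ReflTransGen R' (ι x) z) :
    (∃ y, z = ι y ∧ ReflTransGen R x y) ∨ O z := by
  induction h with
  | refl => exact .inl ⟨x, rfl, .refl⟩
  | tail _ h ih =>
    rcases ih with ⟨y, rfl, h'⟩ | h'
    · rcases hstep _ _ h with ⟨y', rfl, h''⟩ | h''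
      · exact .inl ⟨y', rfl, h'.tail h''⟩
      · exact .inr h''
    · exact .inr (hO _ _ h' h)

theorem path_closed {V : Type} {R : V → V → Prop} {O : V → Prop}
    (hO : ∀ z z', O z → R z z' → O z') {x z : V} (h : ReflTransGen R x z) (hx : O x) : O z := by
  induction h with
  | refl => exact hx
  | tail _ h ih => exact hO _ _ ih h

/-- The restriction of a labelling to a subsystem. -/
def pull {V V' : Type} (F : Lbl V') (ι : V → V') : Lbl V :=
  fun t i x y => F t i (ι x) (ι y)

namespace Emb

variable {V V' : Type} {E : Lbl V} {E' F : Lbl V'} {ι : V → V'} {O : Bool → V' → Prop}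
  {t : Bool} {M : Ordinal.{0}} {x : V} {z : V'}

theorem under_step (h : Emb E E' ι O) (hF : ∀ t x y, Under F t x y ↔ Under E' t x y) {i}
    (hs : F t i (ι x) z) : (∃ y, z = ι y ∧ pull F ι t i x y) ∨ O t z :=
  (h.step _ _ _ ((hF _ _ _).1 ⟨i, hs⟩)).imp_left fun ⟨y, hy, _⟩ => ⟨y, hy, by subst hy; exact hs⟩

theorem under_pull (h : Emb E E' ι O) (hF : ∀ t x y, Under F t x y ↔ Under E' t x y) (t x y) :
    Under (pull F ι) t x y ↔ Under E t x y := by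
  refine ⟨fun ⟨i, hi⟩ => ?_, fun hs => (hF _ _ _).2 (h.lift _ _ _ hs)⟩
  rcases h.step _ _ _ ((hF _ _ _).1 ⟨i, hi⟩) with ⟨y', hy, h'⟩ | h'
  · rwa [h.inj hy]
  · exact (h.notMem _ _ h').elim

theorem under_path (h : Emb E E' ι O) (hp : ReflTransGen (Under E' t) (ι x) z) :
    (∃ y, z = ι y ∧ ReflTransGen (Under E t) x y) ∨ O t z :=
  path_stay (h.step t) (h.closed t) hp

theorem ph_path (h : Emb E E' ι O) (hF : ∀ t x y, Under F t x y ↔ Under E' t x y) {k k'}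
    (hp : ReflTransGen (Ph F t M) (ι x, k) (z, k')) :
    (∃ y, z = ι y ∧ ReflTransGen (Ph (pull F ι) t M) (x, k) (y, k')) ∨ O t z := by
  have := path_stay (R := Ph (pull F ι) t M) (R' := Ph F t M) (ι := Prod.map ι id)
    (O := fun p => O t p.1) (x := (x, k)) (z := (z, k')) ?_ ?_ hp
  · rcases this with ⟨⟨y, k''⟩, h₁, h₂⟩ | h'
    · simp only [Prod.map_apply, id_eq, Prod.mk.injEq] at h₁
      exact .inl ⟨y, h₁.1, h₁.2 ▸ h₂⟩
    · exact .inr h'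
  · rintro ⟨x, k⟩ ⟨z, k'⟩ hs
    rcases hs with ⟨h₁, i, hi, hs⟩ | ⟨h₁, h₂, i, hi, hs⟩
    · rcases h.under_step hF hs with ⟨y, hy, h'⟩ | h'
      · exact .inl ⟨(y, k'), by simpa using hy, .inl ⟨h₁, i, hi, h'⟩⟩
      · exact .inr h'
    · rcases h.under_step hF hs with ⟨y, hy, h'⟩ | h'
      · exact .inl ⟨(y, k'), by simpa using hy, .inr ⟨h₁, h₂, i, hi, h'⟩⟩
      · exact .inr h'
  · intro p q hp hs
    exact h.closed _ _ _ hp ((hF _ _ _).1 hs.under)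

theorem arm (h : Emb E E' ι O) (hF : ∀ t x y, Under F t x y ↔ Under E' t x y) {α β}
    (ha : Arm F t α β (ι x) z) : (∃ y, z = ι y ∧ Arm (pull F ι) t α β x y) ∨ O t z := by
  obtain ⟨b', b'', h₁, h₂, h₃⟩ := ha
  have cl : ∀ z z', O t z → (∃ i, F t i z z') → O t z' := fun z z' hz hs =>
    h.closed _ _ _ hz ((hF _ _ _).1 hs)
  have st : ∀ P : Ordinal.{0} → Prop, ∀ x z, (∃ γ, P γ ∧ F t γ (ι x) z) →
      (∃ y, z = ι y ∧ ∃ γ, P γ ∧ pull F ι t γ x y) ∨ O t z := by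
    rintro P x z ⟨γ, hγ, hs⟩
    exact (h.under_step hF hs).imp_left fun ⟨y, hy, h⟩ => ⟨y, hy, γ, hγ, h⟩
  have leave : O t b'' → O t z := fun hb =>
    path_closed (fun z z' hz ⟨i, _, hs⟩ => cl z z' hz ⟨i, hs⟩) h₃ hb
  rcases path_stay (st (· < α)) (fun z z' hz ⟨i, _, hs⟩ => cl z z' hz ⟨i, hs⟩) h₁ with
    ⟨y, rfl, h₁'⟩ | h'
  · have : (∃ y', b'' = ι y' ∧ (pull F ι t β y y' ∨ y = y')) ∨ O t b'' := by
      rcases h₂ with h₂ | rfl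
      · exact (h.under_step hF h₂).imp_left fun ⟨y', hy, h⟩ => ⟨y', hy, .inl h⟩
      · exact .inl ⟨y, rfl, .inr rfl⟩
    rcases this with ⟨y', rfl, h₂'⟩ | h'
    · rcases path_stay (st fun γ => γ < α ∨ γ < β)
        (fun z z' hz ⟨i, _, hs⟩ => cl z z' hz ⟨i, hs⟩) h₃ with ⟨y'', rfl, h₃'⟩ | h'
      · exact .inl ⟨y'', rfl, y, y', h₁', h₂', h₃'⟩
      · exact .inr h'
    · exact .inr (leave h')
  · refine .inr (leave ?_)
    rcases h₂ with h₂ | rfl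
    · exact cl _ _ h' ⟨_, h₂⟩
    · exact h'

theorem dec_pull (h : Emb E E' ι O) (hF : ∀ t x y, Under F t x y ↔ Under E' t x y)
    (hd : Dec F) : Dec (pull F ι) := by
  intro t α β a b c h₁ h₂
  obtain ⟨d, h₃, h₄⟩ := hd t α β _ _ _ h₁ h₂
  rcases h.arm hF h₃ with ⟨y, rfl, h₃'⟩ | h₃'
  · rcases h.arm hF h₄ with ⟨y', hy, h₄'⟩ | h₄'
    · cases h.inj hy
      exact ⟨y, h₃', h₄'⟩
    · exact (h.notMem _ _ h₄').elim
  · rcases h.arm hF h₄ with ⟨y', rfl, h₄'⟩ | h₄'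
    · exact (h.notMem _ _ h₃').elim
    · cases t
      · exact (h.disj _ h₃' h₄').elim
      · exact (h.disj _ h₄' h₃').elim

end Emb

theorem Arm.lift {V V' : Type} {E : Lbl V} {E' : Lbl V'} {ι : V → V'}
    (h : ∀ t i x y, E t i x y → E' t i (ι x) (ι y)) {t : Bool} {α β : Ordinal.{0}} {b d : V}
    (ha : Arm E t α β b d) : Arm E' t α β (ι b) (ι d) := by
  obtain ⟨b', b'', h₁, h₂, h₃⟩ := ha
  exact ⟨ι b', ι b'', h₁.lift ι fun _ _ ⟨γ, hγ, hs⟩ => ⟨γ, hγ, h _ _ _ _ hs⟩,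
    h₂.imp (h _ _ _ _) (congrArg ι), h₃.lift ι fun _ _ ⟨γ, hγ, hs⟩ => ⟨γ, hγ, h _ _ _ _ hs⟩⟩

/-- A system with labels at most `γ` together with two runs from `A` that cannot both be cheap:
a run of type `true` from `A` to the part below `B`, and a run of type `false` from `A` to `Z`. -/
structure Chain (γ : Ordinal.{0}) (V : Type) where
  E : Lbl V
  dec : Dec E
  le : ∀ t i x y, E t i x y → i ≤ γ
  A : V
  B : V
  Z : V
  runB : ReflTransGen (Under E true) A B
  runZ : ReflTransGen (Under E false) A Z
  deadZ : ∀ t x, ¬ Under E t Z x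
  deadW : ∀ w x, ReflTransGen (Under E false) B w → ¬ Under E true w x
  force : ∀ F : Lbl V, Dec F → (∀ t x y, Under F t x y ↔ Under E t x y) → ∀ M, M ≤ γ →
    ∀ d k k', ReflTransGen (Under E false) B d → ReflTransGen (Ph F true M) (A, true) (d, k) →
      ReflTransGen (Ph F false M) (A, false) (Z, k') → False

theorem Chain.not_DCord {γ : Ordinal.{0}} {V : Type} (C : Chain γ V) :
    ¬ DCord γ (Under C.E false) (Under C.E true) := by
  intro h
  obtain ⟨F, hF, h₁, h₂, h₃⟩ := exists_dec_of_DCord h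
  have hU : ∀ t x y, Under F t x y ↔ Under C.E t x y := by
    rintro (_ | _) x y
    exacts [h₁ x y, h₂ x y]
  have strict : ∀ t k x y, ReflTransGen (Under C.E t) x y →
      ReflTransGen (Ph F t γ) (x, k) (y, k) := fun t k x y hp =>
    ph_path_of_strict (rtg_mono hp fun x y hs => by
      obtain ⟨i, hi⟩ := (hU _ _ _).2 hs
      exact ⟨i, h₃ _ _ _ _ hi, hi⟩)
  exact C.force F hF hU γ le_rfl _ _ _ .refl (strict _ _ _ _ C.runB) (strict _ _ _ _ C.runZ)

theorem DCord_succ {V : Type} {E : Lbl V} (hE : Dec E) {γ : Ordinal.{0}}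
    (hle : ∀ t i x y, E t i x y → i ≤ γ) : DCord (γ + 1) (Under E false) (Under E true) :=
  DCord_of_dec hE (fun _ _ => .rfl) (fun _ _ => .rfl)
    fun t i x y h => Order.lt_add_one_iff.2 (hle t i x y h)

namespace Chain

section base

/-- The vertices of the chain of height `0`. -/
inductive BaseV
  | A | B | Z

/-- The steps of the chain of height `0`. -/
inductive BaseE : Lbl BaseV
  | ab : BaseE true 0 .A .B
  | az : BaseE false 0 .A .Z
  | bz : BaseE false 0 .B .Z

/-- The chain of height `0`. -/
def base : Chain 0 BaseV where
  E := BaseE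
  dec := Dec.of_true fun α β a b c h₁ h₂ => by
    cases h₁; cases h₂
    exact ⟨.Z, .one .bz, .refl⟩
  le t i x y h := by cases h <;> exact le_rfl
  A := .A
  B := .B
  Z := .Z
  runB := .single ⟨0, .ab⟩
  runZ := .single ⟨0, .az⟩
  deadZ := by rintro t x ⟨i, ⟨⟩⟩
  deadW := by
    intro w x hw ⟨i, hi⟩
    cases hi
    obtain ⟨_, _, _, h⟩ := hw.cases_tail.resolve_left (by simp)
    cases h
  force := by
    intro F _ _ M hM d k k' hd h _
    obtain rfl : M = 0 := le_antisymm hM bot_le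
    rcases h.cases_head with h | ⟨⟨x, k''⟩, h, -⟩
    · obtain ⟨rfl, -⟩ := Prod.mk.injEq .. ▸ h
      obtain ⟨_, _, _, h⟩ := hd.cases_tail.resolve_left (by simp)
      cases h
    · obtain ⟨i, -, -, h⟩ := h.of_true.2
      exact not_lt_bot (h rfl)

end base

/-- The vertices of the chain built from countably many smaller ones. -/
inductive StepV (V : ℕ → Type)
  | a (n : ℕ)
  | u (n : ℕ)
  | e
  | z
  | sub (i : ℕ) (v : V i)

namespace StepV

instance {V : ℕ → Type} [∀ i, Countable (V i)] : Countable (StepV V) := by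
  let f : ℕ ⊕ ℕ ⊕ Bool ⊕ (Σ i, V i) → StepV V :=
    Sum.elim .a (Sum.elim .u (Sum.elim (fun t => bif t then .e else .z) fun p => .sub p.1 p.2))
  refine Surjective.countable (f := f) ?_
  rintro (n | n | _ | _ | ⟨i, v⟩)
  exacts [⟨.inl n, rfl⟩, ⟨.inr (.inl n), rfl⟩, ⟨.inr (.inr (.inl true)), rfl⟩,
    ⟨.inr (.inr (.inl false)), rfl⟩, ⟨.inr (.inr (.inr ⟨i, v⟩)), rfl⟩]

end StepV

open StepV

/-- The part of a chain below its vertex `B`. -/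
def W {δ : Ordinal.{0}} {V : Type} (C : Chain δ V) (w : V) : Prop :=
  ReflTransGen (Under C.E false) C.B w

/-- The steps of the chain built from countably many smaller ones. -/
inductive StepE (γ : Ordinal.{0}) {δ : ℕ → Ordinal.{0}} {V : ℕ → Type}
    (C : ∀ i, Chain (δ i) (V i)) : Lbl (StepV V)
  | aa (n) : StepE γ C false 0 (a n) (a (n + 1))
  | az (n k) (h : n = 2 * k + 5) : StepE γ C false 0 (a n) z
  | ue (n) (h : n = 0) : StepE γ C false 0 (u n) e
  | uB (n i) (h : n = 2 * i + 1) : StepE γ C false 0 (u n) (sub i (C i).B)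
  | uA (n i) (h : n = 2 * i + 2) : StepE γ C false 0 (u n) (sub i (C i).A)
  | uz (n k) (h : n = 2 * k + 3) : StepE γ C false 0 (u n) z
  | ez : StepE γ C false 0 e z
  | Zz (i v) (h : v = (C i).Z) : StepE γ C false 0 (sub i v) z
  | inn (t l i v v') (h : (C i).E t l v v') : StepE γ C t l (sub i v) (sub i v')
  | skip (n) : StepE γ C true 0 (a n) (a (n + 2))
  | au (n m) (h : n = m + 2) : StepE γ C true γ (a n) (u m)
  | ue' (n) (h : n = 1) : StepE γ C true 0 (u n) e
  | uA' (n i) (h : n = 2 * i + 2) : StepE γ C true 0 (u n) (sub i (C i).A)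
  | uZ (n i) (h : n = 2 * i + 3) : StepE γ C true 0 (u n) (sub i (C i).Z)
  | We (i w) (h : i = 0) (hw : (C i).W w) : StepE γ C true 0 (sub i w) e
  | WZ (i j w) (h : i = j + 1) (hw : (C i).W w) : StepE γ C true 0 (sub i w) (sub j (C j).Z)

section step

variable {γ : Ordinal.{0}} {δ : ℕ → Ordinal.{0}} {V : ℕ → Type} {C : ∀ i, Chain (δ i) (V i)}

theorem under_lift {t i v v'} (h : ReflTransGen (Under (C i).E t) v v') (hδ : δ i < γ) :
    ReflTransGen (fun x y => ∃ l, l < γ ∧ StepE γ C t l x y) (sub i v) (sub i v') :=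
  h.lift (sub i) fun _ _ ⟨l, hl⟩ => ⟨l, ((C i).le _ _ _ _ hl).trans_lt hδ, .inn _ _ _ _ _ hl⟩

theorem stepE_dec (hγ : 0 < γ) (hδ : ∀ i, δ i < γ) : Dec (StepE γ C) := by
  refine Dec.of_true fun α β x b c h₁ h₂ => ?_
  cases h₁ with
  | skip n =>
    cases h₂ with
    | aa => exact ⟨a (n + 3), .one (.aa _), .one (.skip _)⟩
    | az _ k h => exact ⟨z, .one (.az _ (k + 1) (by omega)), .refl⟩
  | au n m h =>
    subst h
    cases h₂ with
    | aa =>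
      have hu : StepE γ C true γ (a (m + 2 + 1)) (u (m + 1)) := .au _ _ (by omega)
      obtain rfl | ⟨i, rfl⟩ | ⟨i, rfl⟩ :
          m = 0 ∨ (∃ i, m = 2 * i + 1) ∨ ∃ i, m = 2 * i + 2 := by
        rcases Nat.even_or_odd' m with ⟨i, rfl | rfl⟩
        · rcases i with _ | i
          · exact .inl rfl
          · exact .inr (.inr ⟨i, by omega⟩)
        · exact .inr (.inl ⟨i, rfl⟩)
      · exact ⟨e, .one (.ue _ rfl), .one_path hu (.single ⟨0, .inr hγ, .ue' _ rfl⟩)⟩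
      · refine ⟨sub i (C i).B, .one (.uB _ _ rfl), .one_path hu (.head ⟨0, .inr hγ,
          .uA' _ i rfl⟩ (rtg_mono (under_lift (C i).runB (hδ i)) fun _ _ ⟨l, hl, h⟩ =>
            ⟨l, .inr hl, h⟩))⟩
      · refine ⟨sub i (C i).Z, .path (.head ⟨0, hγ, .uA _ i rfl⟩
          (under_lift (C i).runZ (hδ i))), .one_path hu (.single ⟨0, .inr hγ, .uZ _ i rfl⟩)⟩
    | az _ k h => exact ⟨z, .one (.uz _ k (by omega)), .refl⟩
  | ue' n h =>
    cases h₂ with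
    | ue => omega
    | uB _ i h' => exact ⟨e, .refl, .one (.We _ _ (by omega) .refl)⟩
    | uA => omega
    | uz => omega
  | uA' n i h =>
    cases h₂ with
    | ue => omega
    | uB => omega
    | uA _ j h' =>
      obtain rfl : i = j := by omega
      exact ⟨_, .refl, .refl⟩
    | uz => omega
  | uZ n i h =>
    cases h₂ with
    | ue => omega
    | uB _ j h' => exact ⟨_, .refl, .one (.WZ _ _ _ (by omega) .refl)⟩
    | uA => omega
    | uz => exact ⟨z, .one (.Zz _ _ rfl), .refl⟩
  | We i w h hw =>
    cases h₂ with
    | Zz => exact ⟨z, .one .ez, .refl⟩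
    | inn _ l _ _ v' h' => exact ⟨e, .refl, .one (.We _ _ h (hw.tail ⟨_, h'⟩))⟩
  | WZ i j w h hw =>
    cases h₂ with
    | Zz => exact ⟨z, .one (.Zz _ _ rfl), .refl⟩
    | inn _ l _ _ v' h' => exact ⟨_, .refl, .one (.WZ _ _ _ h (hw.tail ⟨_, h'⟩))⟩
  | inn _ l i v v' h =>
    cases h₂ with
    | Zz _ _ h' => exact ((C i).deadZ true v' ⟨_, h' ▸ h⟩).elim
    | inn _ l' _ _ v'' h' =>
      obtain ⟨d, h₃, h₄⟩ := (C i).dec _ _ _ _ _ _ h h'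
      exact ⟨sub i d, h₃.lift fun _ _ _ _ h => .inn _ _ _ _ _ h,
        h₄.lift fun _ _ _ _ h => .inn _ _ _ _ _ h⟩

theorem stepE_le (hδ : ∀ i, δ i < γ) (t l x y) (h : StepE γ C t l x y) : l ≤ γ := by
  cases h <;> first | exact bot_le | exact le_rfl | skip
  next i v v' h => exact ((C i).le _ _ _ _ h).trans (hδ i).le

theorem false_a {n x} (h : Under (StepE γ C) false (a n) x) :
    x = a (n + 1) ∨ x = z ∧ ∃ k, n = 2 * k + 5 := by
  obtain ⟨i, h⟩ := h
  cases h with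
  | aa => exact .inl rfl
  | az _ k h => exact .inr ⟨rfl, k, h⟩

theorem true_a {n x} (h : Under (StepE γ C) true (a n) x) :
    x = a (n + 2) ∨ ∃ m, n = m + 2 ∧ x = u m := by
  obtain ⟨i, h⟩ := h
  cases h with
  | skip => exact .inl rfl
  | au _ m h => exact .inr ⟨m, h, rfl⟩

theorem not_under_z {t x} : ¬ Under (StepE γ C) t z x := by
  rintro ⟨i, ⟨⟩⟩

theorem not_true_e {x} : ¬ Under (StepE γ C) true e x := by
  rintro ⟨i, ⟨⟩⟩

theorem not_true_u_zero {x} : ¬ Under (StepE γ C) true (u 0) x := by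
  rintro ⟨i, h⟩
  cases h <;> omega

theorem false_u {n x} (h : Under (StepE γ C) false (u n) x) :
    (n = 0 ∧ x = e) ∨ (∃ i, n = 2 * i + 1 ∧ x = sub i (C i).B) ∨
      (∃ i, n = 2 * i + 2 ∧ x = sub i (C i).A) ∨ x = z := by
  obtain ⟨i, h⟩ := h
  cases h with
  | ue _ h => exact .inl ⟨h, rfl⟩
  | uB _ i h => exact .inr (.inl ⟨i, h, rfl⟩)
  | uA _ i h => exact .inr (.inr (.inl ⟨i, h, rfl⟩))
  | uz => exact .inr (.inr (.inr rfl))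

theorem true_u {n x} (h : Under (StepE γ C) true (u n) x) :
    (n = 1 ∧ x = e) ∨ (∃ i, n = 2 * i + 2 ∧ x = sub i (C i).A) ∨
      (∃ i, n = 2 * i + 3 ∧ x = sub i (C i).Z) := by
  obtain ⟨i, h⟩ := h
  cases h with
  | ue' _ h => exact .inl ⟨h, rfl⟩
  | uA' _ i h => exact .inr (.inl ⟨i, h, rfl⟩)
  | uZ _ i h => exact .inr (.inr ⟨i, h, rfl⟩)

theorem false_sub {i v x} (h : Under (StepE γ C) false (sub i v) x) :
    (∃ v', x = sub i v' ∧ Under (C i).E false v v') ∨ x = z := by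
  obtain ⟨l, h⟩ := h
  cases h with
  | Zz => exact .inr rfl
  | inn _ _ _ _ v' h => exact .inl ⟨v', rfl, l, h⟩

theorem true_sub {i v x} (h : Under (StepE γ C) true (sub i v) x) :
    (∃ v', x = sub i v' ∧ Under (C i).E true v v') ∨
      (C i).W v ∧ (x = e ∨ ∃ j, j < i ∧ x = sub j (C j).Z) := by
  obtain ⟨l, h⟩ := h
  cases h with
  | inn _ _ _ _ v' h => exact .inl ⟨v', rfl, l, h⟩
  | We _ _ h hw => exact .inr ⟨hw, .inl rfl⟩
  | WZ _ j _ h hw => exact .inr ⟨hw, .inr ⟨j, by omega, rfl⟩⟩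

/-- The vertices at which steps leave the `i`-th subsystem. -/
def Out (C : ∀ i, Chain (δ i) (V i)) (i : ℕ) (t : Bool) (x : StepV V) : Prop :=
  bif t then x = e ∨ ∃ j, j < i ∧ x = sub j (C j).Z else x = z

theorem emb (i : ℕ) : Emb (C i).E (StepE γ C) (sub i) (Out C i) where
  inj x y h := by simpa using h
  step t x y h := by
    cases t
    · exact (false_sub h)
    · exact (true_sub h).imp_right And.right
  lift := by
    rintro t x y ⟨l, h⟩
    exact ⟨l, .inn _ _ _ _ _ h⟩
  closed t x y hx h := by
    cases t
    · cases show x = z from hx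
      exact (not_under_z h).elim
    · rcases show x = e ∨ ∃ j, j < i ∧ x = sub j (C j).Z from hx with rfl | ⟨j, hj, rfl⟩
      · exact (not_true_e h).elim
      · rcases true_sub h with ⟨v', -, h⟩ | ⟨-, rfl | ⟨k, hk, rfl⟩⟩
        · exact ((C j).deadZ _ _ h).elim
        · exact .inl rfl
        · exact .inr ⟨k, hk.trans hj, rfl⟩
  notMem t x h := by
    cases t
    · cases show sub i x = z from h
    · rcases show sub i x = e ∨ ∃ j, j < i ∧ sub i x = sub j (C j).Z from h with h | ⟨j, hj, h⟩
      · cases h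
      · simp only [sub.injEq] at h
        omega
  disj x h h' := by
    cases show x = z from h'
    rcases show z = e ∨ ∃ j, j < i ∧ z = sub j (C j).Z from h with h | ⟨j, hj, h⟩ <;> cases h

end step

section reach

variable {γ : Ordinal.{0}} {δ : ℕ → Ordinal.{0}} {V : ℕ → Type} {C : ∀ i, Chain (δ i) (V i)}

theorem reach_false_a {m x} (h : ReflTransGen (Under (StepE γ C) false) (a m) x) :
    (∃ n, m ≤ n ∧ x = a n) ∨ x = z := by
  refine path_closed (O := fun x => (∃ n, m ≤ n ∧ x = a n) ∨ x = z) ?_ h (.inl ⟨m, le_rfl, rfl⟩)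
  rintro x y (⟨n, hn, rfl⟩ | rfl) hs
  · rcases false_a hs with rfl | ⟨rfl, -⟩
    · exact .inl ⟨n + 1, by omega, rfl⟩
    · exact .inr rfl
  · exact (not_under_z hs).elim

theorem reach_false_u {m x} (h : ReflTransGen (Under (StepE γ C) false) (u m) x) :
    x = u m ∨ x = z ∨ (m = 0 ∧ x = e) ∨
      (∃ i w, m = 2 * i + 1 ∧ (C i).W w ∧ x = sub i w) ∨
      ∃ i w, m = 2 * i + 2 ∧ ReflTransGen (Under (C i).E false) (C i).A w ∧ x = sub i w := by
  refine path_closed (O := fun x => x = u m ∨ x = z ∨ (m = 0 ∧ x = e) ∨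
      (∃ i w, m = 2 * i + 1 ∧ (C i).W w ∧ x = sub i w) ∨
      ∃ i w, m = 2 * i + 2 ∧ ReflTransGen (Under (C i).E false) (C i).A w ∧ x = sub i w)
      ?_ h (.inl rfl)
  rintro x y (rfl | rfl | ⟨rfl, rfl⟩ | ⟨i, w, hi, hw, rfl⟩ | ⟨i, w, hi, hw, rfl⟩) hs
  · rcases false_u hs with ⟨h, rfl⟩ | ⟨i, h, rfl⟩ | ⟨i, h, rfl⟩ | rfl
    · exact .inr (.inr (.inl ⟨h, rfl⟩))
    · exact .inr (.inr (.inr (.inl ⟨i, _, h, .refl, rfl⟩)))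
    · exact .inr (.inr (.inr (.inr ⟨i, _, h, .refl, rfl⟩)))
    · exact .inr (.inl rfl)
  · exact (not_under_z hs).elim
  · obtain ⟨l, ⟨⟩⟩ := hs
    exact .inr (.inl rfl)
  · rcases false_sub hs with ⟨v', rfl, h⟩ | rfl
    · exact .inr (.inr (.inr (.inl ⟨i, v', hi, hw.tail h, rfl⟩)))
    · exact .inr (.inl rfl)
  · rcases false_sub hs with ⟨v', rfl, h⟩ | rfl
    · exact .inr (.inr (.inr (.inr ⟨i, v', hi, hw.tail h, rfl⟩)))
    · exact .inr (.inl rfl)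

theorem reach_true_a {m x} (h : ReflTransGen (Under (StepE γ C) true) (a m) x) :
    (∃ k, x = a (m + 2 * k)) ∨ (∃ n k, n + 2 = m + 2 * k ∧ x = u n) ∨ x = e ∨
      (∃ i v, x = sub i v ∧ (m % 2 = 1 → v = (C i).Z)) := by
  refine path_closed (O := fun x => (∃ k, x = a (m + 2 * k)) ∨
      (∃ n k, n + 2 = m + 2 * k ∧ x = u n) ∨ x = e ∨
      (∃ i v, x = sub i v ∧ (m % 2 = 1 → v = (C i).Z))) ?_ h (.inl ⟨0, rfl⟩)
  rintro x y (⟨k, rfl⟩ | ⟨n, k, hn, rfl⟩ | rfl | ⟨i, v, rfl, hv⟩) hs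
  · rcases true_a hs with rfl | ⟨n, hn, rfl⟩
    · exact .inl ⟨k + 1, rfl⟩
    · exact .inr (.inl ⟨n, k, hn.symm, rfl⟩)
  · rcases true_u hs with ⟨-, rfl⟩ | ⟨i, h, rfl⟩ | ⟨i, h, rfl⟩
    · exact .inr (.inr (.inl rfl))
    · exact .inr (.inr (.inr ⟨i, _, rfl, by omega⟩))
    · exact .inr (.inr (.inr ⟨i, _, rfl, fun _ => rfl⟩))
  · exact (not_true_e hs).elim
  · rcases true_sub hs with ⟨v', rfl, h⟩ | ⟨-, rfl | ⟨k, hk, rfl⟩⟩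
    · refine .inr (.inr (.inr ⟨i, _, rfl, fun hm => ?_⟩))
      exact ((C i).deadZ _ _ (hv hm ▸ h)).elim
    · exact .inr (.inr (.inl rfl))
    · exact .inr (.inr (.inr ⟨k, _, rfl, fun _ => rfl⟩))

end reach

section force

variable {γ : Ordinal.{0}} {δ : ℕ → Ordinal.{0}} {V : ℕ → Type} {C : ∀ i, Chain (δ i) (V i)}
  {F : Lbl (StepV V)} {M : Ordinal.{0}} {φ ψ : Bool}

theorem ph_path_under' (hF : ∀ t x y, Under F t x y ↔ Under (StepE γ C) t x y) {t}
    {p q : StepV V × Bool} (h : ReflTransGen (Ph F t M) p q) :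
    ReflTransGen (Under (StepE γ C) t) p.1 q.1 :=
  rtg_mono (ph_path_under h) fun _ _ => (hF _ _ _).1

theorem bd_false_of_path (hF : ∀ t x y, Under F t x y ↔ Under (StepE γ C) t x y) {n n' k}
    (h : ReflTransGen (Ph F false M) (a n, φ) (a n', k)) (hn : n' ≠ n) :
    Bd F false M φ (a n) (a (n + 1)) := by
  rcases h.cases_head with h | ⟨⟨x, k'⟩, h, h'⟩
  · simp at h
    omega
  · rcases false_a ((hF _ _ _).1 h.under) with h₁ | ⟨h₁, -⟩
    · cases h₁
      exact h.bd
    · cases h₁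
      rcases (ph_path_under' hF h').cases_head with h | ⟨_, h, -⟩
      · cases h
      · exact (not_under_z h).elim

theorem bd_true_of_path (hF : ∀ t x y, Under F t x y ↔ Under (StepE γ C) t x y) {n n' k}
    (h : ReflTransGen (Ph F true M) (a n, φ) (a n', k)) (hn : n' ≠ n) :
    Bd F true M φ (a n) (a (n + 2)) := by
  rcases h.cases_head with h | ⟨⟨x, k'⟩, h, h'⟩
  · simp at h
    omega
  · rcases true_a ((hF _ _ _).1 h.under) with h₁ | ⟨m, -, h₁⟩
    · cases h₁
      exact h.bd
    · cases h₁
      have : ∀ x, ReflTransGen (Under (StepE γ C) true) (u m) x → ∀ j, x ≠ a j := by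
        intro x hx
        refine path_closed (O := fun x => ∀ j, x ≠ a j) ?_ hx (by simp)
        rintro x y hx ⟨i, h⟩ j rfl
        cases h
        exact hx _ rfl
      exact (this _ (ph_path_under' hF h') _ rfl).elim

/-- The steps along the two spines propagate their bounds. -/
theorem spine (hd : Dec F) (hF : ∀ t x y, Under F t x y ↔ Under (StepE γ C) t x y) {n}
    (h₁ : Bd F false M ψ (a n) (a (n + 1))) (h₂ : Bd F true M φ (a n) (a (n + 2))) :
    Bd F true M φ (a (n + 1)) (a (n + 3)) ∧ Bd F false M ψ (a (n + 2)) (a (n + 3)) := by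
  obtain ⟨d, k, k', h₃, h₄⟩ := hd.ph (t := true) h₂ h₁
  rcases reach_false_a (ph_path_under' hF h₄) with ⟨n', hn, h⟩ | h
  · cases h
    have : n' ≠ n + 1 ∧ n' ≠ n + 2 := by
      rcases reach_true_a (ph_path_under' hF h₃) with ⟨l, h⟩ | ⟨_, _, -, h⟩ | h | ⟨_, _, h, -⟩
      · simp only [a.injEq] at h
        omega
      all_goals cases h
    exact ⟨bd_true_of_path hF h₃ this.1, bd_false_of_path hF h₄ this.2⟩
  · cases h
    rcases reach_true_a (ph_path_under' hF h₃) with ⟨l, h⟩ | ⟨_, _, -, h⟩ | h | ⟨_, _, h, -⟩ <;>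
      cases h

theorem spine_all (hd : Dec F) (hF : ∀ t x y, Under F t x y ↔ Under (StepE γ C) t x y) {N}
    (h₁ : Bd F false M ψ (a N) (a (N + 1))) (h₂ : Bd F false M ψ (a (N + 1)) (a (N + 2)))
    (h₃ : Bd F true M φ (a N) (a (N + 2))) (n) (hn : N ≤ n) :
    Bd F false M ψ (a n) (a (n + 1)) ∧ Bd F true M φ (a n) (a (n + 2)) := by
  suffices H : Bd F false M ψ (a n) (a (n + 1)) ∧ Bd F false M ψ (a (n + 1)) (a (n + 2)) ∧
      Bd F true M φ (a n) (a (n + 2)) from ⟨H.1, H.2.2⟩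
  induction n, hn using Nat.le_induction with
  | base => exact ⟨h₁, h₂, h₃⟩
  | succ n _ ih =>
    obtain ⟨h₄, h₅⟩ := spine hd hF ih.1 ih.2.2
    exact ⟨ih.2.1, h₅, h₄⟩

/-- A path leaving the upper spine uses one of the steps down to the vertices `u m`. -/
theorem exists_down (hF : ∀ t x y, Under F t x y ↔ Under (StepE γ C) t x y) {n d k}
    (h : ReflTransGen (Ph F true M) (a n, φ) (d, k)) (hd : ∀ j, d ≠ a j) :
    ∃ l m k', m + 2 = n + 2 * l ∧ Bd F true M φ (a (m + 2)) (u m) ∧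
      (k' = false → Bd F true M true (a (m + 2)) (u m)) ∧ (φ = true → k' = true) ∧
      ReflTransGen (Ph F true M) (u m, k') (d, k) := by
  suffices H : ∀ p : StepV V × Bool, ReflTransGen (Ph F true M) p (d, k) → ∀ n φ, p = (a n, φ) →
      ∃ l m k', m + 2 = n + 2 * l ∧ Bd F true M φ (a (m + 2)) (u m) ∧
      (k' = false → Bd F true M true (a (m + 2)) (u m)) ∧ (φ = true → k' = true) ∧
      ReflTransGen (Ph F true M) (u m, k') (d, k) from H _ h _ _ rfl
  intro p hp
  induction hp using ReflTransGen.head_induction_on with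
  | refl =>
    intro n φ h
    cases h
    exact (hd _ rfl).elim
  | @head p q h h' ih =>
    rintro n φ rfl
    obtain ⟨x, φ'⟩ := q
    rcases true_a ((hF _ _ _).1 h.under) with h₁ | ⟨m, hm, h₁⟩
    · cases h₁
      obtain ⟨l, m, k', hl, h₂, h₃, h₄, h₅⟩ := ih _ _ rfl
      have : φ = true → φ' = true := by
        rintro rfl
        exact h.of_true.1
      refine ⟨l + 1, m, k', by omega, ?_, h₃, fun h => h₄ (this h), h₅⟩
      obtain ⟨i, h₆, h₇, h₈⟩ := h₂
      exact ⟨i, h₆, h₇, fun h => h₈ (this h)⟩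
    · cases h₁
      subst hm
      refine ⟨0, m, φ', rfl, h.bd, ?_, ?_, h'⟩
      · rintro rfl
        exact h.to_false.2
      · rintro rfl
        exact h.of_true.1

/-- The `i`-th subsystem has a cheap run of type `true`. -/
def RunT (C : ∀ i, Chain (δ i) (V i)) (F : Lbl (StepV V)) (M : Ordinal.{0}) (i : ℕ) : Prop :=
  ∃ w k, (C i).W w ∧ ReflTransGen (Ph F true M) (sub i (C i).A, true) (sub i w, k)

/-- The `i`-th subsystem has a cheap run of type `false`. -/
def RunF (C : ∀ i, Chain (δ i) (V i)) (F : Lbl (StepV V)) (M : Ordinal.{0}) (i : ℕ) : Prop :=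
  ∃ k, ReflTransGen (Ph F false M) (sub i (C i).A, false) (sub i (C i).Z, k)

theorem not_runT_runF (hd : Dec F) (hF : ∀ t x y, Under F t x y ↔ Under (StepE γ C) t x y) {i}
    (hM : M ≤ δ i) (h₁ : RunT C F M i) (h₂ : RunF C F M i) : False := by
  obtain ⟨w, k, hw, h₁⟩ := h₁
  obtain ⟨k', h₂⟩ := h₂
  rcases (emb i).ph_path hF h₁ with ⟨y, hy, h₁⟩ | h
  · cases (emb (γ := γ) (C := C) i).inj hy
    rcases (emb i).ph_path hF h₂ with ⟨y, hy, h₂⟩ | h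
    · cases (emb (γ := γ) (C := C) i).inj hy
      exact (C i).force _ ((emb i).dec_pull hF hd) ((emb i).under_pull hF) M hM _ _ _ hw h₁ h₂
    · exact (emb (γ := γ) (C := C) i).notMem _ _ h
  · exact (emb (γ := γ) (C := C) i).notMem _ _ h

theorem sub_or_exit (hF : ∀ t x y, Under F t x y ↔ Under (StepE γ C) t x y) {i v k}
    {q : StepV V × Bool} (h : ReflTransGen (Ph F true M) (sub i v, k) q) :
    (∃ v', q.1 = sub i v') ∨
      ∃ w k', (C i).W w ∧ ReflTransGen (Ph F true M) (sub i v, k) (sub i w, k') := by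
  induction h with
  | refl => exact .inl ⟨v, rfl⟩
  | @tail p q hp h ih =>
    rcases ih with ⟨v', hv⟩ | h'
    · obtain ⟨x, k'⟩ := p
      cases hv
      rcases true_sub ((hF _ _ _).1 h.under) with ⟨v'', h₁, -⟩ | ⟨hw, -⟩
      · exact .inl ⟨v'', h₁⟩
      · exact .inr ⟨v', k', hw, hp⟩
    · exact .inr h'

theorem down_peak (hd : Dec F) (hF : ∀ t x y, Under F t x y ↔ Under (StepE γ C) t x y) {m}
    (h₁ : Bd F false M false (a (m + 2)) (a (m + 3))) (h₂ : Bd F true M φ (a (m + 2)) (u m)) :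
    ∃ d k k' l m' k'', m' = m + 1 + 2 * l ∧ Bd F true M φ (a (m' + 2)) (u m') ∧
      (k'' = false → Bd F true M true (a (m' + 2)) (u m')) ∧ (φ = true → k'' = true) ∧
      ReflTransGen (Ph F true M) (u m', k'') (d, k) ∧
      ReflTransGen (Ph F true M) (a (m + 3), φ) (d, k) ∧
      ReflTransGen (Ph F false M) (u m, false) (d, k') ∧ d ≠ u m := by
  obtain ⟨d, k, k', h₃, h₄⟩ := hd.ph (t := true) h₂ h₁
  have hda : ∀ j, d ≠ a j := by
    rintro j rfl
    rcases reach_false_u (ph_path_under' hF h₄) with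
      h | h | ⟨-, h⟩ | ⟨_, _, -, -, h⟩ | ⟨_, _, -, -, h⟩ <;> cases h
  obtain ⟨l, m', k'', hl, h₅, h₆, h₇, h₈⟩ := exists_down hF h₃ hda
  refine ⟨d, k, k', l, m', k'', by omega, h₅, h₆, h₇, h₈, h₃, h₄, ?_⟩
  rintro rfl
  rcases reach_true_a (ph_path_under' hF h₃) with ⟨_, h⟩ | ⟨n, k, hn, h⟩ | h | ⟨_, _, h, -⟩
  · cases h
  · simp only [u.injEq] at h
    omega
  · cases h
  · cases h

theorem down_next (hd : Dec F) (hF : ∀ t x y, Under F t x y ↔ Under (StepE γ C) t x y) {m}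
    (h₁ : Bd F false M false (a (m + 2)) (a (m + 3))) (h₂ : Bd F true M φ (a (m + 2)) (u m)) :
    ∃ m', m < m' ∧ (m' + m) % 2 = 1 ∧ Bd F true M φ (a (m' + 2)) (u m') := by
  obtain ⟨-, -, -, l, m', -, hm, h, -⟩ := down_peak hd hF h₁ h₂
  exact ⟨m', by omega, by omega, h⟩

theorem runF_of_down (hd : Dec F) (hF : ∀ t x y, Under F t x y ↔ Under (StepE γ C) t x y) {i}
    (h₁ : Bd F false M false (a (2 * i + 4)) (a (2 * i + 5)))
    (h₂ : Bd F true M φ (a (2 * i + 4)) (u (2 * i + 2))) : RunF C F M i := by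
  obtain ⟨d, k, k', l, m', k'', -, -, -, -, -, h₃, h₄, hu⟩ := down_peak hd hF h₁ h₂
  have h₅ := reach_true_a (ph_path_under' hF h₃)
  rcases reach_false_u (ph_path_under' hF h₄) with
    h | h | ⟨h, -⟩ | ⟨j, w, hj, -, h⟩ | ⟨j, w, hj, -, h⟩
  · exact (hu h).elim
  · cases h
    rcases h₅ with ⟨_, h⟩ | ⟨_, _, -, h⟩ | h | ⟨_, _, h, -⟩ <;> cases h
  · omega
  · omega
  · obtain rfl : i = j := by omega
    cases h
    obtain rfl : w = (C i).Z := by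
      rcases h₅ with ⟨_, h⟩ | ⟨_, _, -, h⟩ | h | ⟨j, v, h, hv⟩
      · cases h
      · cases h
      · cases h
      · cases h
        exact hv (by omega)
    rcases h₄.cases_head with h | ⟨⟨x, k₁⟩, h, h'⟩
    · cases h
    · rcases false_u ((hF _ _ _).1 h.under) with ⟨h, -⟩ | ⟨j, hj, -⟩ | ⟨j, hj, h⟩ | h
      · omega
      · omega
      · obtain rfl : i = j := by omega
        cases h
        cases k₁
        · exact ⟨_, h'⟩
        · exact ⟨_, ph_path_weaken h'⟩
      · cases h
        rcases (ph_path_under' hF h').cases_head with h | ⟨_, h, -⟩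
        · cases h
        · exact (not_under_z h).elim

theorem runT_of_down (hd : Dec F) (hF : ∀ t x y, Under F t x y ↔ Under (StepE γ C) t x y) {i}
    (h₁ : Bd F false M false (a (2 * i + 3)) (a (2 * i + 4)))
    (h₂ : Bd F true M φ (a (2 * i + 3)) (u (2 * i + 1))) :
    ∃ j, i ≤ j ∧ Bd F true M φ (a (2 * j + 4)) (u (2 * j + 2)) ∧
      (RunT C F M j ∨ φ = false ∧ Bd F true M true (a (2 * j + 4)) (u (2 * j + 2))) := by
  obtain ⟨d, k, k', l, m', k'', hm, h₃, h₄, h₅, h₆, h₇, h₈, hu⟩ := down_peak hd hF h₁ h₂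
  obtain rfl : m' = 2 * (i + l) + 2 := by omega
  refine ⟨i + l, by omega, h₃, ?_⟩
  have h₉ := reach_true_a (ph_path_under' hF h₇)
  rcases reach_false_u (ph_path_under' hF h₈) with
    h | h | ⟨h, -⟩ | ⟨j, w, hj, hw, h⟩ | ⟨j, w, hj, -, h⟩
  · exact (hu h).elim
  · cases h
    rcases h₉ with ⟨_, h⟩ | ⟨_, _, -, h⟩ | h | ⟨_, _, h, -⟩ <;> cases h
  · omega
  · obtain rfl : i = j := by omega
    cases h
    rcases h₆.cases_head with h | ⟨⟨x, k₁⟩, h, h'⟩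
    · cases h
    rcases true_u ((hF _ _ _).1 h.under) with ⟨h, -⟩ | ⟨j, hj, h₁₀⟩ | ⟨j, hj, -⟩
    · omega
    · obtain rfl : j = i + l := by omega
      cases h₁₀
      have hrun : ∃ w k, (C (i + l)).W w ∧
          ReflTransGen (Ph F true M) (sub (i + l) (C (i + l)).A, k₁) (sub (i + l) w, k) := by
        rcases sub_or_exit hF h' with ⟨v', hv⟩ | ⟨w', k₂, hw', h''⟩
        · obtain rfl | hl := Nat.eq_zero_or_pos l
          · exact ⟨w, k, hw, h'⟩
          · simp only [sub.injEq] at hv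
            omega
        · exact ⟨w', k₂, hw', h''⟩
      obtain ⟨w', k₂, hw', h''⟩ := hrun
      cases k₁
      · have := h.to_false.1
        subst this
        refine .inr ⟨?_, h₄ rfl⟩
        cases φ
        · rfl
        · cases h₅ rfl
      · exact .inl ⟨w', k₂, hw', h''⟩
    · omega
  · omega

theorem down_above (hd : Dec F) (hF : ∀ t x y, Under F t x y ↔ Under (StepE γ C) t x y) {N m}
    (h₁ : ∀ n, N ≤ n → Bd F false M false (a n) (a (n + 1)))
    (h₂ : Bd F true M φ (a (m + 2)) (u m)) (hm : N ≤ m + 2) (K : ℕ) :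
    ∃ i, K ≤ i ∧ Bd F true M φ (a (2 * i + 3)) (u (2 * i + 1)) := by
  have H : ∀ K, ∃ m', K ≤ m' ∧ m ≤ m' ∧ Bd F true M φ (a (m' + 2)) (u m') := by
    intro K
    induction K with
    | zero => exact ⟨m, by omega, le_rfl, h₂⟩
    | succ K ih =>
      obtain ⟨m', h₃, h₄, h₅⟩ := ih
      obtain ⟨m'', h₆, -, h₇⟩ := down_next hd hF (h₁ (m' + 2) (by omega)) h₅
      exact ⟨m'', by omega, by omega, h₇⟩
  obtain ⟨m', h₃, h₄, h₅⟩ := H (2 * K + 1)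
  rcases Nat.even_or_odd' m' with ⟨i, rfl | rfl⟩
  · obtain ⟨m'', h₆, h₇, h₈⟩ := down_next hd hF (h₁ _ (by omega)) h₅
    obtain ⟨i', rfl⟩ : ∃ i', m'' = 2 * i' + 1 := ⟨m'' / 2, by omega⟩
    exact ⟨i', by omega, h₈⟩
  · exact ⟨i, by omega, h₅⟩

/-- The labels of the lower spine and of the steps down cannot be bounded below `γ`. -/
theorem not_bounded (hd : Dec F) (hF : ∀ t x y, Under F t x y ↔ Under (StepE γ C) t x y)
    {I : ℕ} (hI : ∀ i, I ≤ i → M ≤ δ i) {N m}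
    (h₁ : ∀ n, N ≤ n → Bd F false M false (a n) (a (n + 1)))
    (h₂ : Bd F true M false (a (m + 2)) (u m)) (hm : N ≤ m) : False := by
  have key : ∃ φ m, N ≤ m ∧ Bd F true M φ (a (m + 2)) (u m) ∧
      (φ = false → ∀ m, N ≤ m → ¬ Bd F true M true (a (m + 2)) (u m)) := by
    by_cases h : ∃ m, N ≤ m ∧ Bd F true M true (a (m + 2)) (u m)
    · obtain ⟨m, hm, h⟩ := h
      exact ⟨true, m, hm, h, by simp⟩
    · exact ⟨false, m, hm, h₂, fun _ m hm hb => h ⟨m, hm, hb⟩⟩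
  obtain ⟨φ, m, hm, h₃, h₄⟩ := key
  obtain ⟨i, hi, h₅⟩ := down_above hd hF h₁ h₃ (by omega) (max I N)
  have hiI : I ≤ i := le_of_max_le_left hi
  have hiN : N ≤ i := le_of_max_le_right hi
  obtain ⟨j, hj, h₆, h₇⟩ := runT_of_down hd hF (h₁ _ (by omega)) h₅
  have h₈ := runF_of_down hd hF (h₁ _ (by omega)) h₆
  rcases h₇ with h₇ | ⟨h₇, h₉⟩
  · exact not_runT_runF hd hF (hI j (by omega)) h₇ h₈
  · exact h₄ h₇ _ (by omega) h₉

theorem peel (hF : ∀ t x y, Under F t x y ↔ Under (StepE γ C) t x y) {n k} (hn : n < 5)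
    (h : ReflTransGen (Ph F false M) (a n, φ) (z, k)) :
    ∃ φ', Ph F false M (a n, φ) (a (n + 1), φ') ∧
      ReflTransGen (Ph F false M) (a (n + 1), φ') (z, k) := by
  rcases h.cases_head with h | ⟨⟨x, φ'⟩, h, h'⟩
  · cases h
  · rcases false_a ((hF _ _ _).1 h.under) with h₁ | ⟨-, k, hk⟩
    · cases h₁
      exact ⟨φ', h, h'⟩
    · omega

theorem Bd.exists_lt {V : Type} {F : Lbl V} {t : Bool} {M : Ordinal.{0}} {x y : V}
    (h : Bd F t M true x y) : ∃ M', M' < M ∧ ∀ M'', M' ≤ M'' → Bd F t M'' false x y :=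
  let ⟨i, h, _, h'⟩ := h
  ⟨i, h' rfl, fun _ hi => ⟨i, h, hi, by simp⟩⟩

theorem step_force (hd : Dec F) (hF : ∀ t x y, Under F t x y ↔ Under (StepE γ C) t x y)
    (hδ : ∀ M, M < γ → ∃ I, ∀ i, I ≤ i → M ≤ δ i) (hM : M ≤ γ) {d k k'}
    (hW : ReflTransGen (Under (StepE γ C) false) (u 0) d)
    (h₁ : ReflTransGen (Ph F true M) (a 0, true) (d, k))
    (h₂ : ReflTransGen (Ph F false M) (a 0, false) (z, k')) : False := by
  obtain ⟨φ₁, p₀, h₃⟩ := peel hF (by omega) h₂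
  obtain ⟨φ₂, p₁, h₄⟩ := peel hF (by omega) h₃
  obtain ⟨φ₃, p₂, h₅⟩ := peel hF (by omega) h₄
  obtain ⟨φ₄, p₃, -⟩ := peel hF (by omega) h₅
  have hda : ∀ j, d ≠ a j := by
    rintro j rfl
    rcases reach_false_u hW with h | h | ⟨-, h⟩ | ⟨_, _, -, -, h⟩ | ⟨_, _, -, -, h⟩ <;> cases h
  obtain ⟨-, m₀, -, -, hU, -⟩ := exists_down hF h₁ hda
  have hσ : Bd F true M true (a 0) (a 2) := by
    rcases h₁.cases_head with h | ⟨⟨x, φ'⟩, h, -⟩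
    · cases h
      exact (hda _ rfl).elim
    · rcases true_a ((hF _ _ _).1 h.under) with h₁ | ⟨m, hm, -⟩
      · cases h₁
        exact h.bd
      · omega
  have all := spine_all hd hF p₀.bd.weaken p₁.bd.weaken hσ
  obtain ⟨N, hN, hN'⟩ : ∃ N, Bd F false M true (a N) (a (N + 1)) ∧
      Bd F false M true (a (N + 1)) (a (N + 2)) := by
    cases φ₂
    · obtain ⟨rfl, h⟩ := p₁.to_false
      exact ⟨0, p₀.to_false.2, h⟩
    · obtain ⟨rfl, h⟩ := p₂.of_true
      exact ⟨2, h, p₃.of_true.2⟩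
  obtain ⟨i, hi, hU'⟩ := down_above hd hF (fun n hn => (all n hn).1) hU (Nat.zero_le _) N
  obtain ⟨M₁, hM₁, b₁⟩ := Bd.exists_lt hN
  obtain ⟨M₂, hM₂, b₂⟩ := Bd.exists_lt hN'
  obtain ⟨M₃, hM₃, b₃⟩ := Bd.exists_lt (all N (Nat.zero_le _)).2
  obtain ⟨M₄, hM₄, b₄⟩ := Bd.exists_lt hU'
  have hlt : max (max M₁ M₂) (max M₃ M₄) < M := by simp [*]
  have all' := spine_all hd hF (b₁ _ (by simp)) (b₂ _ (by simp)) (b₃ (max (max M₁ M₂) (max M₃ M₄))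
    (by simp))
  obtain ⟨I, hI⟩ := hδ _ (hlt.trans_le hM)
  exact not_bounded hd hF hI (fun n hn => (all' n hn).1) (b₄ _ (by simp)) (by omega)

end force

/-- The chain built from a sequence of smaller chains with cofinal heights. -/
def step {γ : Ordinal.{0}} {δ : ℕ → Ordinal.{0}} {V : ℕ → Type} (C : ∀ i, Chain (δ i) (V i))
    (hlt : ∀ i, δ i < γ) (hδ : ∀ M, M < γ → ∃ I, ∀ i, I ≤ i → M ≤ δ i) : Chain γ (StepV V) where
  E := StepE γ C
  dec := stepE_dec (bot_le.trans_lt (hlt 0)) hlt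
  le := stepE_le hlt
  A := a 0
  B := u 0
  Z := z
  runB := .head ⟨0, .skip 0⟩ (.single ⟨γ, .au _ _ rfl⟩)
  runZ := .head ⟨0, .aa 0⟩ (.head ⟨0, .aa 1⟩ (.head ⟨0, .aa 2⟩ (.head ⟨0, .aa 3⟩
    (.head ⟨0, .aa 4⟩ (.single ⟨0, .az _ 0 rfl⟩)))))
  deadZ _ _ := not_under_z
  deadW w x hw h := by
    rcases reach_false_u hw with rfl | rfl | ⟨-, rfl⟩ | ⟨i, _, hi, -, -⟩ | ⟨i, _, hi, -, -⟩
    · exact not_true_u_zero h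
    · exact not_under_z h
    · exact not_true_e h
    · omega
    · omega
  force _ hd hF _ hM _ _ _ hW h₁ h₂ := step_force hd hF hδ hM hW h₁ h₂

theorem exists_cofinal_seq {γ : Ordinal.{0}} (h0 : γ ≠ 0) (hγ : γ.card ≤ Cardinal.aleph0) :
    ∃ δ : ℕ → Ordinal.{0}, (∀ i, δ i < γ) ∧ ∀ M, M < γ → ∃ I, ∀ i, I ≤ i → M ≤ δ i := by
  have : Nonempty γ.ToType := Ordinal.nonempty_toType_iff.2 h0
  have : Countable γ.ToType := by
    rwa [← Cardinal.mk_le_aleph0_iff, Cardinal.mk_toType]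
  obtain ⟨f, hf⟩ := exists_surjective_nat γ.ToType
  refine ⟨fun i => (Ordinal.ToType.mk.symm (partialSups f i)).1,
    fun i => (Ordinal.ToType.mk.symm (partialSups f i)).2, ?_⟩
  intro M hM
  obtain ⟨I, hI⟩ := hf (Ordinal.ToType.mk ⟨M, hM⟩)
  refine ⟨I, fun i hi => ?_⟩
  have h := Ordinal.ToType.mk.symm.monotone (le_partialSups_of_le f hi)
  rw [hI, OrderIso.symm_apply_apply] at h
  exact h

theorem exists_chain (γ : Ordinal.{0}) (hγ : γ.card ≤ Cardinal.aleph0) :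
    ∃ V : Type, Countable V ∧ Nonempty (Chain γ V) := by
  induction γ using WellFoundedLT.induction with
  | ind γ ih =>
    rcases eq_or_ne γ 0 with rfl | h0
    · refine ⟨BaseV, ?_, ⟨base⟩⟩
      have : Surjective (fun n : ℕ => if n = 0 then BaseV.A else if n = 1 then .B else .Z) := by
        rintro (_ | _ | _)
        exacts [⟨0, rfl⟩, ⟨1, rfl⟩, ⟨2, rfl⟩]
      exact this.countable
    · obtain ⟨δ, hlt, hδ⟩ := exists_cofinal_seq h0 hγ
      choose V hV C using fun i => ih (δ i) (hlt i) ((Ordinal.card_le_card (hlt i).le).trans hγ)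
      exact ⟨StepV V, inferInstance, ⟨step (fun i => (C i).some) hlt hδ⟩⟩

end Chain

section countable

/-- The restriction of a labelled family to the labels in `L`. -/
def restr {V : Type} (F : Lbl V) (L : Set Ordinal.{0}) : Lbl V :=
  fun t i x y => i ∈ L ∧ F t i x y

variable {V : Type} {F : Lbl V} {t : Bool} {α β : Ordinal.{0}} {b c d : V}

theorem path_support {P : Ordinal.{0} → Prop} {x y : V}
    (h : ReflTransGen (fun x y => ∃ γ, P γ ∧ F t γ x y) x y) :
    ∃ S : Set Ordinal.{0}, S.Countable ∧ ∀ L, S ⊆ L →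
      ReflTransGen (fun x y => ∃ γ, P γ ∧ restr F L t γ x y) x y := by
  induction h with
  | refl => exact ⟨∅, Set.countable_empty, fun _ _ => .refl⟩
  | tail _ h ih =>
    obtain ⟨S, hS, ih⟩ := ih
    obtain ⟨γ, hγ, h⟩ := h
    exact ⟨insert γ S, hS.insert γ, fun L hL => (ih L ((Set.subset_insert _ _).trans hL)).tail
      ⟨γ, hγ, hL (Set.mem_insert _ _), h⟩⟩

theorem Arm.support (h : Arm F t α β b d) :
    ∃ S : Set Ordinal.{0}, S.Countable ∧ ∀ L, S ⊆ L → Arm (restr F L) t α β b d := by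
  obtain ⟨b', b'', h₁, h₂, h₃⟩ := h
  obtain ⟨S₁, hS₁, h₁⟩ := path_support h₁
  obtain ⟨S₃, hS₃, h₃⟩ := path_support h₃
  refine ⟨insert β (S₁ ∪ S₃), (hS₁.union hS₃).insert β, fun L hL =>
    ⟨b', b'', h₁ L ?_, h₂.imp_left fun h => ⟨hL (Set.mem_insert _ _), h⟩, h₃ L ?_⟩⟩
  · exact fun x hx => hL (.inr (.inl hx))
  · exact fun x hx => hL (.inr (.inr hx))

theorem Join.support (h : Join F t α β b c) :
    ∃ S : Set Ordinal.{0}, S.Countable ∧ ∀ L, S ⊆ L → Join (restr F L) t α β b c := by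
  obtain ⟨d, h₁, h₂⟩ := h
  obtain ⟨S₁, hS₁, h₁⟩ := h₁.support
  obtain ⟨S₂, hS₂, h₂⟩ := h₂.support
  exact ⟨S₁ ∪ S₂, hS₁.union hS₂, fun L hL => ⟨d, h₁ L (Set.subset_union_left.trans hL),
    h₂ L (Set.subset_union_right.trans hL)⟩⟩

/-- A decreasing family on a countable set can be thinned out to countably many labels. -/
theorem exists_countable_labels [Countable V] (hF : Dec F) :
    ∃ L : Set Ordinal.{0}, L.Countable ∧ Dec (restr F L) ∧
      ∀ t x y, Under F t x y → Under (restr F L) t x y := by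
  have hJ : ∀ t α β b c, ∃ S : Set Ordinal.{0}, S.Countable ∧
      (Join F t α β b c → ∀ L, S ⊆ L → Join (restr F L) t α β b c) := by
    intro t α β b c
    by_cases h : Join F t α β b c
    · obtain ⟨S, hS, h'⟩ := h.support
      exact ⟨S, hS, fun _ => h'⟩
    · exact ⟨∅, Set.countable_empty, fun h' => (h h').elim⟩
  choose S hS hJ using hJ
  have hE : ∀ p : Bool × V × V, ∃ i, Under F p.1 p.2.1 p.2.2 → F p.1 i p.2.1 p.2.2 := by
    intro p
    by_cases h : Under F p.1 p.2.1 p.2.2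
    · exact h.imp fun _ h _ => h
    · exact ⟨0, fun h' => (h h').elim⟩
  choose lab hlab using hE
  let next (L : Set Ordinal.{0}) : Set Ordinal.{0} :=
    L ∪ ⋃ α ∈ L, ⋃ β ∈ L, ⋃ p : Bool × V × V, S p.1 α β p.2.1 p.2.2
  let L (n : ℕ) : Set Ordinal.{0} := next^[n] (Set.range lab)
  have hsucc : ∀ n, L (n + 1) = next (L n) := fun n => Function.iterate_succ_apply' _ _ _
  have hmono : Monotone L := monotone_nat_of_le_succ fun n => by
    rw [hsucc]
    exact Set.subset_union_left
  have hcount : ∀ n, (L n).Countable := by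
    intro n
    induction n with
    | zero => exact Set.countable_range _
    | succ n ih =>
      rw [hsucc]
      exact ih.union (ih.biUnion fun α _ => ih.biUnion fun β _ =>
        Set.countable_iUnion fun p => hS _ _ _ _ _)
  refine ⟨⋃ n, L n, Set.countable_iUnion hcount, ?_, ?_⟩
  · rintro t α β a b c ⟨hα, h₁⟩ ⟨hβ, h₂⟩
    obtain ⟨m, hm⟩ := Set.mem_iUnion.1 hα
    obtain ⟨n, hn⟩ := Set.mem_iUnion.1 hβ
    refine hJ t α β b c (hF _ _ _ _ _ _ h₁ h₂) _ fun x hx => Set.mem_iUnion.2 ⟨max m n + 1, ?_⟩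
    rw [hsucc]
    refine .inr (Set.mem_biUnion (hmono (le_max_left _ _) hm)
      (Set.mem_biUnion (hmono (le_max_right _ _) hn) (Set.mem_iUnion.2 ⟨(t, b, c), hx⟩)))
  · intro t x y h
    exact ⟨lab (t, x, y), Set.mem_iUnion.2 ⟨0, Set.mem_range_self _⟩, hlab (t, x, y) h⟩

open scoped Ordinal in
theorem exists_rank (f : ℕ → Ordinal.{0}) :
    ∃ g : ℕ → Ordinal.{0}, (∀ n, g n < ω₁) ∧ ∀ m n, f m < f n → g m < g n := by
  let r (m n : ℕ) : Prop := f m < f n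
  have wf : IsWellFounded ℕ r := ⟨InvImage.wf f wellFounded_lt⟩
  refine ⟨IsWellFounded.rank r, fun n => ?_, fun m n h => IsWellFounded.rank_lt_of_rel h⟩
  induction n using wf.wf.induction with
  | h n ih =>
    rw [IsWellFounded.rank_eq]
    exact Ordinal.iSup_lt_omega_one fun m => (Cardinal.isSuccLimit_omega 1).succ_lt (ih m m.2)

open scoped Ordinal in
/-- On countable sets the hierarchy collapses at `ω₁`. -/
theorem DCord_omega_one [Countable V] {δ : Ordinal.{0}} {r s : V → V → Prop} (h : DCord δ r s) :
    DCord ω₁ r s := by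
  obtain ⟨F, hF, hr, hs, -⟩ := exists_dec_of_DCord h
  obtain ⟨L, hL, hd, hU⟩ := exists_countable_labels hF
  obtain ⟨f, hf⟩ := Set.countable_iff_exists_subset_range.1 hL
  obtain ⟨g, hg, hlt⟩ := exists_rank f
  let G : Lbl V := fun t i x y => ∃ n, g n = i ∧ restr F L t (f n) x y
  have hGU : ∀ t x y, Under G t x y ↔ Under F t x y := by
    refine fun t x y => ⟨fun ⟨_, n, _, h⟩ => ⟨f n, h.2⟩, fun h => ?_⟩
    obtain ⟨i, hi, h⟩ := hU t x y h
    obtain ⟨n, rfl⟩ := hf hi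
    exact ⟨g n, n, rfl, hi, h⟩
  refine DCord_of_dec (F := G) ?_ (fun x y => (hGU _ _ _).trans (hr x y))
    (fun x y => (hGU _ _ _).trans (hs x y)) ?_
  · rintro t _ _ a b c ⟨m, rfl, h₁⟩ ⟨n, rfl, h₂⟩
    have key : ∀ t m n b d, Arm (restr F L) t (f m) (f n) b d → Arm G t (g m) (g n) b d := by
      rintro t m n b d ⟨b', b'', h₁, h₂, h₃⟩
      refine ⟨b', b'', rtg_mono h₁ ?_, h₂.imp_left fun h => ⟨n, rfl, h⟩, rtg_mono h₃ ?_⟩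
      · rintro x y ⟨γ, hγ, h⟩
        obtain ⟨k, rfl⟩ := hf h.1
        exact ⟨g k, hlt _ _ hγ, k, rfl, h⟩
      · rintro x y ⟨γ, hγ, h⟩
        obtain ⟨k, rfl⟩ := hf h.1
        exact ⟨g k, hγ.imp (hlt _ _) (hlt _ _), k, rfl, h⟩
    obtain ⟨d, h₃, h₄⟩ := hd t _ _ a b c h₁ h₂
    exact ⟨d, key _ _ _ _ _ h₃, key _ _ _ _ _ h₄⟩
  · rintro t _ x y ⟨n, rfl, -⟩
    exact hg n

end countable

/-- A system with labels at most `γ` and designated steps, one of which has to be labelled at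
least `γ`. By `rigid`, joining the target of a designated step with the source of another one
of the same kind is possible only if the two agree and only by following this step. -/
structure Sys (γ : Ordinal.{0}) (V : Type) where
  E : Lbl V
  dec : Dec E
  le : ∀ t i x y, E t i x y → i ≤ γ
  des : Bool → Bool → V → V → Prop
  des_under : ∀ t κ x x', des t κ x x' → Under E t x x'
  rigid : ∀ t κ x x' x₁ x₁' d, des t κ x x' → des t κ x₁ x₁' → ReflTransGen (Under E t) x₁ d →
    ReflTransGen (Under E (!t)) x' d → x₁ = x ∧ d ≠ x ∧
      ∀ z, Under E t x z → ReflTransGen (Under E t) z d → z = x'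
  force : ∀ F : Lbl V, Dec F → (∀ t x y, Under F t x y ↔ Under E t x y) →
    ∃ t κ x x', des t κ x x' ∧ ∀ i, F t i x x' → γ ≤ i

namespace Sys

theorem not_DCord {γ : Ordinal.{0}} {V : Type} (S : Sys γ V) :
    ¬ DCord γ (Under S.E false) (Under S.E true) := by
  intro h
  obtain ⟨F, hF, h₁, h₂, h₃⟩ := exists_dec_of_DCord h
  have hU : ∀ t x y, Under F t x y ↔ Under S.E t x y := by
    rintro (_ | _) x y
    exacts [h₁ x y, h₂ x y]
  obtain ⟨t, κ, x, x', hx, h⟩ := S.force F hF hU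
  obtain ⟨i, hi⟩ := (hU _ _ _).2 (S.des_under _ _ _ _ hx)
  exact (h₃ _ _ _ _ hi).not_ge (h i hi)

theorem nonempty {γ : Ordinal.{0}} {V : Type} (S : Sys γ V) : Nonempty V :=
  let ⟨_, _, x, _⟩ := S.force S.E S.dec fun _ _ _ => .rfl; ⟨x⟩

/-- A path from the source of a designated step in a subsystem to a common reduct with the target
of such a step follows that step. -/
theorem bd_of_join {γ M : Ordinal.{0}} {V V' : Type} (S : Sys γ V) {E' F : Lbl V'} {ι : V → V'}
    {O : Bool → V' → Prop} (h : Emb S.E E' ι O) (hF : ∀ t x y, Under F t x y ↔ Under E' t x y)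
    {t κ k k' x x' x₁ x₁' d} (hx : S.des t κ x x') (hx₁ : S.des t κ x₁ x₁')
    (hp : ReflTransGen (Ph F t M) (ι x₁, k) (d, k'))
    (hq : ReflTransGen (Under E' (!t)) (ι x') d) : x₁ = x ∧ Bd F t M k (ι x) (ι x') := by
  rcases h.ph_path hF hp with ⟨v, rfl, hp'⟩ | h₁
  · rcases h.under_path hq with ⟨v', hv, hq'⟩ | h₂
    · cases h.inj hv
      have under : ∀ {p q : V × Bool}, ReflTransGen (Ph (pull F ι) t M) p q →
          ReflTransGen (Under S.E t) p.1 q.1 := fun hp =>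
        rtg_mono (ph_path_under hp) fun _ _ => (h.under_pull hF _ _ _).1
      obtain ⟨rfl, hne, hz⟩ := S.rigid _ _ _ _ _ _ _ hx hx₁ (under hp') hq'
      refine ⟨rfl, ?_⟩
      rcases hp'.cases_head with h₁ | ⟨⟨z, k₁⟩, h₁, h₂⟩
      · cases h₁
        exact (hne rfl).elim
      · obtain rfl := hz z ((h.under_pull hF _ _ _).1 h₁.under) (under h₂)
        exact h₁.bd
    · exact (h.notMem _ _ h₂).elim
  · rcases h.under_path hq with ⟨v', rfl, hq'⟩ | h₂
    · exact (h.notMem _ _ h₁).elim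
    · cases t
      · exact (h.disj _ h₂ h₁).elim
      · exact (h.disj _ h₁ h₂).elim

section base

/-- The only step of the system of height `0`. -/
inductive BaseE : Lbl Bool
  | step : BaseE true 0 false true

/-- The system of height `0`. -/
def base : Sys 0 Bool where
  E := BaseE
  dec := Dec.of_true fun α β a b c h₁ h₂ => by cases h₂
  le t i x y h := by cases h; exact le_rfl
  des t _ x y := Under BaseE t x y
  des_under t _ x x' h := h
  rigid := by
    rintro t κ x x' x₁ x₁' d ⟨_, ⟨⟩⟩ ⟨_, ⟨⟩⟩ h₁ h₂
    have : d = true := by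
      rcases h₂.cases_head with h | ⟨_, ⟨_, ⟨⟩⟩, -⟩
      exact h.symm
    subst this
    refine ⟨rfl, by simp, ?_⟩
    rintro z ⟨_, ⟨⟩⟩ -
    rfl
  force F _ hF := ⟨true, true, false, true, ⟨0, .step⟩, fun _ _ => bot_le⟩

end base

section strip

variable {δ : Ordinal.{0}} {V : Type}

/-- Two designated steps of the same type, placed in two of three copies of a system. -/
structure Line (S : Sys δ V) where
  T : Bool
  fst : Fin 3
  snd : Fin 3
  ord : bif T then fst < snd else snd < fst
  κ : Bool
  κ' : Bool
  x : V
  x' : V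
  y : V
  y' : V
  hx : S.des T κ x x'
  hy : S.des T κ' y y'

/-- The vertices of the successor construction. -/
inductive StripV (S : Sys δ V)
  | cp (k : Fin 3) (v : V)
  | a₀ (L : Line S)
  | a₁ (L : Line S)
  | a₂ (L : Line S)
  | u₀ (L : Line S)
  | u₁ (L : Line S)
  | u₂ (L : Line S)
  | w (L : Line S)
  | om

open StripV

/-- The line `L` has steps of type `t` leaving the copy with index `k`. -/
def Line.Ex {S : Sys δ V} (L : Line S) (t : Bool) (k : Fin 3) : Prop :=
  (t = !L.T) ∧ k = L.fst ∨ t = L.T ∧ k = L.snd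

/-- The steps of the successor construction. -/
inductive StripE (S : Sys δ V) : Lbl (StripV S)
  | inn (k t l v v') (h : S.E t l v v') : StripE S t l (cp k v) (cp k v')
  | a₀₁ (L t) (h : t = !L.T) : StripE S t (δ + 1) (a₀ L) (a₁ L)
  | a₁₂ (L t) (h : t = !L.T) : StripE S t (δ + 1) (a₁ L) (a₂ L)
  | au₀ (L t) (h : t = L.T) : StripE S t 0 (a₀ L) (u₀ L)
  | au₁ (L t) (h : t = L.T) : StripE S t 0 (a₁ L) (u₁ L)
  | au₂ (L t) (h : t = L.T) : StripE S t 0 (a₂ L) (u₂ L)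
  | ux₀ (L t) (h : t = !L.T) : StripE S t 0 (u₀ L) (cp L.fst L.x')
  | ux₁ (L t) (h : t = L.T) : StripE S t 0 (u₁ L) (cp L.fst L.x)
  | uy₁ (L t) (h : t = !L.T) : StripE S t 0 (u₁ L) (cp L.snd L.y')
  | uy₂ (L t) (h : t = L.T) : StripE S t 0 (u₂ L) (cp L.snd L.y)
  | exx (L t k v) (h : t = !L.T) (hk : k = L.fst) (hv : ReflTransGen (Under S.E L.T) L.x v) :
      StripE S t 0 (cp k v) (w L)
  | exy (L t k v) (h : t = L.T) (hk : k = L.snd)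
      (hv : ReflTransGen (Under S.E (!L.T)) L.y' v) : StripE S t 0 (cp k v) (w L)
  | wom (L t) (h : L.Ex (!t) 1) : StripE S t 0 (w L) om

variable {S : Sys δ V}

theorem Line.ex_lt {L : Line S} {k k' : Fin 3} (h : L.Ex false k) (h' : L.Ex true k') :
    k < k' := by
  have := L.ord
  unfold Line.Ex at h h'
  cases hT : L.T <;> simp_all

theorem Line.ex_one {L L' : Line S} {t : Bool} {k : Fin 3} (h : L.Ex t k) (h' : L'.Ex (!t) k) :
    k = 1 := by
  have ne0 : ∀ {L : Line S}, L.Ex true k → k ≠ 0 := by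
    rintro L h rfl
    have := L.ord
    unfold Line.Ex at h
    cases hT : L.T <;> simp_all <;> omega
  have ne2 : ∀ {L : Line S}, L.Ex false k → k ≠ 2 := by
    rintro L h rfl
    have := L.ord
    unfold Line.Ex at h
    cases hT : L.T <;> simp_all <;> omega
  cases t
  · have := ne2 h
    have := ne0 h'
    omega
  · have := ne0 h
    have := ne2 h'
    omega

theorem strip_peak₀ (L : Line S) : Join (StripE S) L.T 0 (δ + 1) (u₀ L) (a₁ L) := by
  obtain ⟨l, hl⟩ := S.des_under _ _ _ _ L.hx
  have h0 : 0 < δ + 1 := bot_le.trans_lt (Order.lt_add_one_iff.2 le_rfl)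
  exact ⟨cp L.fst L.x', .path_right (.single ⟨0, h0, .ux₀ L _ rfl⟩),
    .path (.head ⟨0, h0, .au₁ L _ rfl⟩ (.head ⟨0, h0, .ux₁ L _ rfl⟩
      (.single ⟨l, Order.lt_add_one_iff.2 (S.le _ _ _ _ hl), .inn _ _ _ _ _ hl⟩)))⟩

theorem strip_peak₁ (L : Line S) : Join (StripE S) L.T 0 (δ + 1) (u₁ L) (a₂ L) := by
  obtain ⟨l, hl⟩ := S.des_under _ _ _ _ L.hy
  have h0 : 0 < δ + 1 := bot_le.trans_lt (Order.lt_add_one_iff.2 le_rfl)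
  exact ⟨cp L.snd L.y', .path_right (.single ⟨0, h0, .uy₁ L _ rfl⟩),
    .path (.head ⟨0, h0, .au₂ L _ rfl⟩ (.head ⟨0, h0, .uy₂ L _ rfl⟩
      (.single ⟨l, Order.lt_add_one_iff.2 (S.le _ _ _ _ hl), .inn _ _ _ _ _ hl⟩)))⟩

theorem strip_peak₂ (L : Line S) :
    Join (StripE S) L.T 0 0 (cp L.fst L.x) (cp L.snd L.y') :=
  ⟨w L, .one (.exx L _ _ _ rfl rfl .refl), .one (.exy L _ _ _ rfl rfl .refl)⟩

/-- A step leaving a copy. -/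
theorem strip_cp {t l k v p} (h : StripE S t l (cp k v) p) :
    (∃ v', p = cp k v' ∧ S.E t l v v') ∨ ∃ L, p = w L ∧ l = 0 ∧ L.Ex t k ∧
      ∀ v' l', S.E (!t) l' v v' → StripE S t 0 (cp k v') (w L) := by
  cases h with
  | inn _ _ _ _ v' h => exact .inl ⟨v', rfl, h⟩
  | exx L _ _ _ h hk hv =>
    refine .inr ⟨L, rfl, rfl, .inl ⟨h, hk⟩, fun v' l' hs => .exx _ _ _ _ h hk (hv.tail ⟨l', ?_⟩)⟩
    simpa [h] using hs
  | exy L _ _ _ h hk hv =>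
    refine .inr ⟨L, rfl, rfl, .inr ⟨h, hk⟩, fun v' l' hs => .exy _ _ _ _ h hk (hv.tail ⟨l', ?_⟩)⟩
    simpa [h] using hs

theorem strip_peak_cp {t α β k v p q} (h₁ : StripE S t α (cp k v) p)
    (h₂ : StripE S (!t) β (cp k v) q) : Join (StripE S) t α β p q := by
  rcases strip_cp h₁ with ⟨v₁, rfl, h₃⟩ | ⟨L, rfl, rfl, h₃, h₄⟩
  · rcases strip_cp h₂ with ⟨v₂, rfl, h₅⟩ | ⟨L', rfl, rfl, h₅, h₆⟩
    · obtain ⟨d, h₇, h₈⟩ := S.dec _ _ _ _ _ _ h₃ h₅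
      exact ⟨cp k d, h₇.lift fun _ _ _ _ h => .inn _ _ _ _ _ h,
        h₈.lift fun _ _ _ _ h => .inn _ _ _ _ _ h⟩
    · exact ⟨w L', .one (h₆ _ _ (by simpa using h₃)), .refl⟩
  · rcases strip_cp h₂ with ⟨v₂, rfl, h₅⟩ | ⟨L', rfl, rfl, h₅, h₆⟩
    · exact ⟨w L, .refl, .one (h₄ _ _ h₅)⟩
    · obtain rfl := Line.ex_one h₃ h₅
      exact ⟨om, .one (.wom _ _ (by simpa using h₃)), .one (.wom _ _ h₅)⟩

theorem strip_dec : Dec (StripE S) := by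
  intro t α β p b c h₁ h₂
  cases p with
  | cp => exact strip_peak_cp h₁ h₂
  | a₀ L =>
    cases h₁ with
    | a₀₁ _ _ h =>
      cases h₂ with
      | a₀₁ _ _ h' => simp [h] at h'
      | au₀ => exact h ▸ (strip_peak₀ L).symm
    | au₀ _ _ h =>
      cases h₂ with
      | a₀₁ => exact h ▸ strip_peak₀ L
      | au₀ _ _ h' => simp [h] at h'
  | a₁ L =>
    cases h₁ with
    | a₁₂ _ _ h =>
      cases h₂ with
      | a₁₂ _ _ h' => simp [h] at h'
      | au₁ => exact h ▸ (strip_peak₁ L).symm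
    | au₁ _ _ h =>
      cases h₂ with
      | a₁₂ => exact h ▸ strip_peak₁ L
      | au₁ _ _ h' => simp [h] at h'
  | a₂ L =>
    cases h₁ with
    | au₂ _ _ h => cases h₂ with
      | au₂ _ _ h' => simp [h] at h'
  | u₀ L =>
    cases h₁ with
    | ux₀ _ _ h => cases h₂ with
      | ux₀ _ _ h' => simp [h] at h'
  | u₁ L =>
    cases h₁ with
    | uy₁ _ _ h =>
      cases h₂ with
      | uy₁ _ _ h' => simp [h] at h'
      | ux₁ => exact h ▸ (strip_peak₂ L).symm
    | ux₁ _ _ h =>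
      cases h₂ with
      | uy₁ => exact h ▸ strip_peak₂ L
      | ux₁ _ _ h' => simp [h] at h'
  | u₂ L =>
    cases h₁ with
    | uy₂ _ _ h => cases h₂ with
      | uy₂ _ _ h' => simp [h] at h'
  | w L =>
    cases h₁ with
    | wom _ _ h =>
      cases h₂ with
      | wom _ _ h' =>
        cases t
        · exact ((Line.ex_lt h' h).false).elim
        · exact ((Line.ex_lt h h').false).elim
  | om => cases h₁

theorem strip_le (t l p q) (h : StripE S t l p q) : l ≤ δ + 1 := by
  cases h <;> first | exact bot_le | exact le_rfl | skip
  next h => exact (S.le _ _ _ _ h).trans (Order.lt_add_one_iff.2 le_rfl).le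

/-- The vertices at which steps leave the copy with index `k`. -/
def StripOut (S : Sys δ V) (k : Fin 3) (t : Bool) (p : StripV S) : Prop :=
  (∃ L, p = w L ∧ L.Ex t k) ∨ p = om ∧ k = bif t then 2 else 0

theorem strip_emb (k : Fin 3) : Emb S.E (StripE S) (cp k) (StripOut S k) where
  inj x y h := by simpa using h
  step t x p := by
    rintro ⟨l, h⟩
    rcases strip_cp h with ⟨v', rfl, h'⟩ | ⟨L, rfl, -, h', -⟩
    · exact .inl ⟨v', rfl, l, h'⟩
    · exact .inr (.inl ⟨L, rfl, h'⟩)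
  lift := by
    rintro t x y ⟨l, h⟩
    exact ⟨l, .inn _ _ _ _ _ h⟩
  closed := by
    rintro t p q (⟨L, rfl, h⟩ | ⟨rfl, -⟩) ⟨l, h'⟩
    · cases h' with
      | wom _ _ h' =>
        refine .inr ⟨rfl, ?_⟩
        cases t
        · have := Line.ex_lt h h'
          simp only [cond_false]
          omega
        · have := Line.ex_lt h' h
          simp only [cond_true]
          omega
    · cases h'
  notMem := by
    rintro t x (⟨L, h, -⟩ | ⟨h, -⟩) <;> cases h
  disj := by
    rintro p (⟨L, rfl, h⟩ | ⟨rfl, h⟩) (⟨L', h₁, h'⟩ | ⟨h₁, h'⟩)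
    · cases h₁
      exact (Line.ex_lt h' h).false
    · cases h₁
    · cases h₁
    · simp [h] at h'

/-- The part of the successor construction below the lines. -/
def Post (p : StripV S) : Prop := (∃ k v, p = cp k v) ∨ (∃ L, p = w L) ∨ p = om

theorem Post.closed {t} (p q : StripV S) (hp : Post p) (h : Under (StripE S) t p q) : Post q := by
  obtain ⟨l, h⟩ := h
  rcases hp with ⟨k, v, rfl⟩ | ⟨L, rfl⟩ | rfl
  · rcases strip_cp h with ⟨v', rfl, -⟩ | ⟨L, rfl, -⟩
    · exact .inl ⟨_, _, rfl⟩
    · exact .inr (.inl ⟨_, rfl⟩)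
  · cases h
    exact .inr (.inr rfl)
  · cases h

/-- The designated steps of the successor construction. -/
def StripDes (S : Sys δ V) (t κ : Bool) (p q : StripV S) : Prop :=
  ∃ L : Line S, (κ = false ∧ (t = !L.T) ∧ p = a₀ L ∧ q = a₁ L) ∨
    (κ = false ∧ t = L.T ∧ p = a₀ L ∧ q = u₀ L) ∨
    (κ = true ∧ (t = !L.T) ∧ p = a₁ L ∧ q = a₂ L)

theorem under_a₀ {t} {L : Line S} {q} (h : Under (StripE S) t (a₀ L) q) :
    (t = !L.T) ∧ q = a₁ L ∨ t = L.T ∧ q = u₀ L := by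
  obtain ⟨l, h⟩ := h
  cases h with
  | a₀₁ _ _ h => exact .inl ⟨h, rfl⟩
  | au₀ _ _ h => exact .inr ⟨h, rfl⟩

theorem under_a₁ {t} {L : Line S} {q} (h : Under (StripE S) t (a₁ L) q) :
    (t = !L.T) ∧ q = a₂ L ∨ t = L.T ∧ q = u₁ L := by
  obtain ⟨l, h⟩ := h
  cases h with
  | a₁₂ _ _ h => exact .inl ⟨h, rfl⟩
  | au₁ _ _ h => exact .inr ⟨h, rfl⟩

theorem under_a₂ {t} {L : Line S} {q} (h : Under (StripE S) t (a₂ L) q) :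
    t = L.T ∧ q = u₂ L := by
  obtain ⟨l, h⟩ := h
  cases h with
  | au₂ _ _ h => exact ⟨h, rfl⟩

theorem under_u₀ {t} {L : Line S} {q} (h : Under (StripE S) t (u₀ L) q) :
    (t = !L.T) ∧ q = cp L.fst L.x' := by
  obtain ⟨l, h⟩ := h
  cases h with
  | ux₀ _ _ h => exact ⟨h, rfl⟩

theorem under_u₁ {t} {L : Line S} {q} (h : Under (StripE S) t (u₁ L) q) :
    t = L.T ∧ q = cp L.fst L.x ∨ (t = !L.T) ∧ q = cp L.snd L.y' := by
  obtain ⟨l, h⟩ := h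
  cases h with
  | ux₁ _ _ h => exact .inl ⟨h, rfl⟩
  | uy₁ _ _ h => exact .inr ⟨h, rfl⟩

theorem under_u₂ {t} {L : Line S} {q} (h : Under (StripE S) t (u₂ L) q) :
    t = L.T ∧ q = cp L.snd L.y := by
  obtain ⟨l, h⟩ := h
  cases h with
  | uy₂ _ _ h => exact ⟨h, rfl⟩

theorem post_cp {k v} : Post (cp k v : StripV S) := .inl ⟨k, v, rfl⟩

theorem reach_a₁ {L : Line S} {q} (h : ReflTransGen (Under (StripE S) L.T) (a₁ L) q) :
    q = a₁ L ∨ q = u₁ L ∨ Post q := by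
  refine path_closed (O := fun q => q = a₁ L ∨ q = u₁ L ∨ Post q) ?_ h (.inl rfl)
  rintro p q (rfl | rfl | hp) h
  · rcases under_a₁ h with ⟨h, -⟩ | ⟨-, rfl⟩
    · simp at h
    · exact .inr (.inl rfl)
  · rcases under_u₁ h with ⟨-, rfl⟩ | ⟨h, -⟩
    · exact .inr (.inr post_cp)
    · simp at h
  · exact .inr (.inr (hp.closed _ _ h))

theorem reach_a₂ {L : Line S} {t q} (h : ReflTransGen (Under (StripE S) t) (a₂ L) q) :
    q = a₂ L ∨ q = u₂ L ∨ Post q := by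
  refine path_closed (O := fun q => q = a₂ L ∨ q = u₂ L ∨ Post q) ?_ h (.inl rfl)
  rintro p q (rfl | rfl | hp) h
  · exact .inr (.inl (under_a₂ h).2)
  · exact .inr (.inr ((under_u₂ h).2 ▸ post_cp))
  · exact .inr (.inr (hp.closed _ _ h))

theorem reach_u₀ {L : Line S} {t q} (h : ReflTransGen (Under (StripE S) t) (u₀ L) q) :
    q = u₀ L ∨ Post q := by
  refine path_closed (O := fun q => q = u₀ L ∨ Post q) ?_ h (.inl rfl)
  rintro p q (rfl | hp) h
  · exact .inr ((under_u₀ h).2 ▸ post_cp)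
  · exact .inr (hp.closed _ _ h)

theorem reach_a₀ {L : Line S} {t q} (h : ReflTransGen (Under (StripE S) t) (a₀ L) q) :
    (t = !L.T) ∧ (q = a₀ L ∨ q = a₁ L ∨ q = a₂ L) ∨ t = L.T ∧ (q = a₀ L ∨ q = u₀ L) := by
  by_cases ht : t = L.T
  · subst ht
    refine .inr ⟨rfl, path_closed (O := fun q => q = a₀ L ∨ q = u₀ L) ?_ h (.inl rfl)⟩
    rintro p q (rfl | rfl) h
    · rcases under_a₀ h with ⟨h, -⟩ | ⟨-, rfl⟩
      · simp at h
      · exact .inr rfl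
    · simpa using (under_u₀ h).1
  · refine .inl ⟨Bool.eq_not.2 ht, path_closed (O := fun q => q = a₀ L ∨ q = a₁ L ∨ q = a₂ L)
      ?_ h (.inl rfl)⟩
    rintro p q (rfl | rfl | rfl) h
    · rcases under_a₀ h with ⟨-, rfl⟩ | ⟨h, -⟩
      · exact .inr (.inl rfl)
      · exact (ht h).elim
    · rcases under_a₁ h with ⟨-, rfl⟩ | ⟨h, -⟩
      · exact .inr (.inr rfl)
      · exact (ht h).elim
    · exact (ht (under_a₂ h).1).elim

theorem strip_rigid (t κ) (x x' x₁ x₁' d : StripV S) (hx : StripDes S t κ x x')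
    (hx₁ : StripDes S t κ x₁ x₁') (h₁ : ReflTransGen (Under (StripE S) t) x₁ d)
    (h₂ : ReflTransGen (Under (StripE S) (!t)) x' d) : x₁ = x ∧ d ≠ x ∧
      ∀ z, Under (StripE S) t x z → ReflTransGen (Under (StripE S) t) z d → z = x' := by
  obtain ⟨L, ⟨rfl, rfl, rfl, rfl⟩ | ⟨rfl, rfl, rfl, rfl⟩ | ⟨rfl, rfl, rfl, rfl⟩⟩ := hx
  · have h₃ := reach_a₁ (by simpa using h₂)
    obtain ⟨L₁, hL⟩ := hx₁
    obtain rfl : x₁ = a₀ L₁ := by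
      rcases hL with ⟨-, -, h, -⟩ | ⟨-, -, h, -⟩ | ⟨⟨⟩, -⟩ <;> exact h
    have hd : d = a₁ L ∧ L₁ = L := by
      rcases reach_a₀ h₁ with ⟨-, rfl | rfl | rfl⟩ | ⟨-, rfl | rfl⟩ <;>
        simp_all [Post]
    obtain ⟨rfl, rfl⟩ := hd
    refine ⟨rfl, by simp, fun z hz _ => ?_⟩
    rcases under_a₀ hz with ⟨-, h⟩ | ⟨h, -⟩
    · exact h
    · simp at h
  · have h₃ := reach_u₀ h₂
    obtain ⟨L₁, hL⟩ := hx₁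
    obtain rfl : x₁ = a₀ L₁ := by
      rcases hL with ⟨-, -, h, -⟩ | ⟨-, -, h, -⟩ | ⟨⟨⟩, -⟩ <;> exact h
    have hd : d = u₀ L ∧ L₁ = L := by
      rcases reach_a₀ h₁ with ⟨-, rfl | rfl | rfl⟩ | ⟨-, rfl | rfl⟩ <;>
        simp_all [Post]
    obtain ⟨rfl, rfl⟩ := hd
    refine ⟨rfl, by simp, fun z hz _ => ?_⟩
    rcases under_a₀ hz with ⟨h, -⟩ | ⟨-, h⟩
    · simp at h
    · exact h
  · have h₃ := reach_a₂ h₂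
    obtain ⟨L₁, ⟨⟨⟩, -⟩ | ⟨⟨⟩, -⟩ | ⟨-, hT, rfl, rfl⟩⟩ := hx₁
    have hd : d = a₂ L ∧ L₁ = L := by
      have : d = a₁ L₁ ∨ d = a₂ L₁ := by
        refine path_closed (O := fun q => q = a₁ L₁ ∨ q = a₂ L₁) ?_ h₁ (.inl rfl)
        rintro p q (rfl | rfl) h
        · rcases under_a₁ h with ⟨-, rfl⟩ | ⟨h, -⟩
          · exact .inr rfl
          · simp [h] at hT
        · simp [(under_a₂ h).1] at hT
      rcases this with rfl | rfl <;> simp_all [Post]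
    obtain ⟨rfl, rfl⟩ := hd
    refine ⟨rfl, by simp, fun z hz _ => ?_⟩
    rcases under_a₁ hz with ⟨-, h⟩ | ⟨h, -⟩
    · exact h
    · simp at h

/-- Three copies of a system contain two expensive designated steps of the same type. -/
theorem exists_line {F : Lbl (StripV S)} (hd : Dec F)
    (hF : ∀ t x y, Under F t x y ↔ Under (StripE S) t x y) :
    ∃ L : Line S, (∀ i, F L.T i (cp L.fst L.x) (cp L.fst L.x') → δ ≤ i) ∧
      ∀ i, F L.T i (cp L.snd L.y) (cp L.snd L.y') → δ ≤ i := by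
  have := fun k : Fin 3 => S.force _ ((strip_emb (S := S) k).dec_pull hF hd)
    ((strip_emb (S := S) k).under_pull hF)
  choose t κ x x' hx h using this
  obtain ⟨k, k', hk, ht⟩ : ∃ k k', k < k' ∧ t k = t k' := by
    obtain ⟨k, k', hne, h⟩ := Fintype.exists_ne_map_eq_of_card_lt t (by simp)
    rcases lt_or_gt_of_ne hne with hlt | hlt
    exacts [⟨k, k', hlt, h⟩, ⟨k', k, hlt, h.symm⟩]
  cases hT : t k
  · exact ⟨⟨t k, k', k, by simpa [hT] using hk, _, _, _, _, _, _, ht ▸ hx k', hx k⟩,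
      fun i hi => h k' i (ht ▸ hi), h k⟩
  · exact ⟨⟨t k, k, k', by simpa [hT] using hk, _, _, _, _, _, _, hx k, ht ▸ hx k'⟩,
      h k, fun i hi => h k' i (ht ▸ hi)⟩

theorem strip_force (F : Lbl (StripV S)) (hd : Dec F)
    (hF : ∀ t x y, Under F t x y ↔ Under (StripE S) t x y) :
    ∃ t κ p q, StripDes S t κ p q ∧ ∀ i, F t i p q → δ + 1 ≤ i := by
  by_contra! H
  obtain ⟨L, hx, hy⟩ := exists_line hd hF
  have bd : ∀ {t κ p q}, StripDes S t κ p q → Bd F t δ false p q := fun h =>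
    let ⟨i, hi, hl⟩ := H _ _ _ _ h
    ⟨i, hi, Order.lt_add_one_iff.1 hl, by simp⟩
  have under : ∀ {t} {p q : StripV S × Bool}, ReflTransGen (Ph F t δ) p q →
      ReflTransGen (Under (StripE S) t) p.1 q.1 := fun hp =>
    rtg_mono (ph_path_under hp) fun _ _ => (hF _ _ _).1
  have hU : Bd F L.T δ true (a₁ L) (u₁ L) := by
    obtain ⟨d, k, k', h₁, h₂⟩ := hd.ph (t := L.T) (bd ⟨L, .inr (.inl ⟨rfl, rfl, rfl, rfl⟩)⟩)
      (bd ⟨L, .inl ⟨rfl, rfl, rfl, rfl⟩⟩)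
    have hne : ReflTransGen (Under (StripE S) (!L.T)) (cp L.fst L.x') d := by
      rcases (under h₂).cases_head with h | ⟨p, h, h'⟩
      · subst h
        rcases reach_a₁ (under h₁) with h | h | h <;> simp [Post] at h
      · exact (under_u₀ h).2 ▸ h'
    rcases h₁.cases_head with h | ⟨⟨p, k₁⟩, h₃, h₁⟩
    · cases h
      rcases path_closed (Post.closed) hne post_cp with ⟨_, _, h⟩ | ⟨_, h⟩ | h <;> cases h
    rcases under_a₁ ((hF _ _ _).1 h₃.under) with ⟨h, -⟩ | ⟨-, h⟩
    · simp at h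
    cases h
    rcases h₁.cases_head with h | ⟨⟨p, k₂⟩, h₄, h₁⟩
    · cases h
      rcases path_closed (Post.closed) hne post_cp with ⟨_, _, h⟩ | ⟨_, h⟩ | h <;> cases h
    rcases under_u₁ ((hF _ _ _).1 h₄.under) with ⟨-, h⟩ | ⟨h, -⟩
    swap
    · simp at h
    cases h
    obtain ⟨-, i, h₅, -, h₆⟩ := S.bd_of_join (strip_emb L.fst) hF L.hx L.hx h₁ hne
    cases k₂
    · obtain ⟨rfl, -⟩ := h₄.to_false
      exact h₃.to_false.2
    · exact ((hx i h₅).not_gt (h₆ rfl)).elim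
  obtain ⟨d, k, k', h₁, h₂⟩ := hd.ph (t := L.T) hU (bd ⟨L, .inr (.inr ⟨rfl, rfl, rfl, rfl⟩)⟩)
  have hne : ReflTransGen (Under (StripE S) (!L.T)) (cp L.snd L.y') d := by
    rcases (under h₂).cases_head with h | ⟨p, h, h'⟩
    · subst h
      rcases reach_a₂ (under h₁) with h | h | h <;> simp [Post] at h
    · rcases under_u₁ h with ⟨h, -⟩ | ⟨-, h⟩
      · simp at h
      · exact h ▸ h'
  rcases h₁.cases_head with h | ⟨⟨p, k₁⟩, h₃, h₁⟩
  · cases h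
    rcases path_closed (Post.closed) hne post_cp with ⟨_, _, h⟩ | ⟨_, h⟩ | h <;> cases h
  obtain ⟨rfl, -⟩ := h₃.of_true
  obtain ⟨-, h⟩ := under_a₂ ((hF _ _ _).1 h₃.under)
  cases h
  rcases h₁.cases_head with h | ⟨⟨p, k₂⟩, h₄, h₁⟩
  · cases h
    rcases path_closed (Post.closed) hne post_cp with ⟨_, _, h⟩ | ⟨_, h⟩ | h <;> cases h
  obtain ⟨rfl, -⟩ := h₄.of_true
  obtain ⟨-, h⟩ := under_u₂ ((hF _ _ _).1 h₄.under)
  cases h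
  obtain ⟨-, i, h₅, -, h₆⟩ := S.bd_of_join (strip_emb L.snd) hF L.hy L.hy h₁ hne
  exact (hy i h₅).not_gt (h₆ rfl)

/-- The successor construction. -/
def strip (S : Sys δ V) : Sys (δ + 1) (StripV S) where
  E := StripE S
  dec := strip_dec
  le := strip_le
  des := StripDes S
  des_under := by
    rintro t κ x x' ⟨L, ⟨-, h, rfl, rfl⟩ | ⟨-, h, rfl, rfl⟩ | ⟨-, h, rfl, rfl⟩⟩
    exacts [⟨_, .a₀₁ L t h⟩, ⟨_, .au₀ L t h⟩, ⟨_, .a₁₂ L t h⟩]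
  rigid := strip_rigid
  force := strip_force

end strip

section limit

variable {γ : Ordinal.{0}} {I : Type} {o : I → Ordinal.{0}} {V : I → Type}

/-- A designated step of given kind in one of several systems. -/
structure Choice (S : ∀ n, Sys (o n) (V n)) (T κ : Bool) where
  n : I
  x : V n
  x' : V n
  hx : (S n).des T κ x x'

/-- The vertices of the limit construction. -/
inductive BipV (S : ∀ n, Sys (o n) (V n))
  | bk (i n : I) (v : V n)
  | rt (T κ : Bool)
  | c (T κ : Bool) (i : I)
  | b (T κ : Bool) (j : I → Option (Choice S T κ))
  | om (T κ : Bool) (i : I) (j : I → Option (Choice S T κ))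

open BipV

/-- The steps of the limit construction. -/
inductive BipE (γ : Ordinal.{0}) (S : ∀ n, Sys (o n) (V n)) : Lbl (BipV S)
  | inn (i n t l v v') (h : (S n).E t l v v') : BipE γ S t l (bk i n v) (bk i n v')
  | rc (T κ i t) (h : t = !T) : BipE γ S t γ (rt T κ) (c T κ i)
  | rb (T κ j t) (h : t = T) : BipE γ S t 0 (rt T κ) (b T κ j)
  | cx (T κ i t) (q : Choice S T κ) (h : t = T) : BipE γ S t 0 (c T κ i) (bk i q.n q.x)
  | bx (T κ i j t q) (h : t = !T) (hj : j i = some q) : BipE γ S t 0 (b T κ j) (bk i q.n q.x')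
  | co (T κ i j t) (h : t = T) (hj : j i = none) : BipE γ S t 0 (c T κ i) (om T κ i j)
  | bo (T κ i j t) (h : t = !T) (hj : j i = none) : BipE γ S t 0 (b T κ j) (om T κ i j)

variable {S : ∀ n, Sys (o n) (V n)}

theorem bip_peak (hγ : 0 < γ) (ho : ∀ n, o n < γ) (T κ : Bool) (i : I)
    (j : I → Option (Choice S T κ)) : Join (BipE γ S) T 0 γ (b T κ j) (c T κ i) := by
  cases hj : j i with
  | none =>
    exact ⟨om T κ i j, .path_right (.single ⟨0, hγ, .bo _ _ _ _ _ rfl hj⟩),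
      .path (.single ⟨0, hγ, .co _ _ _ _ _ rfl hj⟩)⟩
  | some q =>
    obtain ⟨l, hl⟩ := (S q.n).des_under _ _ _ _ q.hx
    exact ⟨bk i q.n q.x', .path_right (.single ⟨0, hγ, .bx _ _ _ _ _ _ rfl hj⟩),
      .path (.head ⟨0, hγ, .cx _ _ _ _ q rfl⟩
        (.single ⟨l, ((S q.n).le _ _ _ _ hl).trans_lt (ho _), .inn _ _ _ _ _ _ hl⟩))⟩

theorem bip_dec (hγ : 0 < γ) (ho : ∀ n, o n < γ) : Dec (BipE γ S) := by
  intro t α β p q₁ q₂ h₁ h₂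
  cases p with
  | bk i n v =>
    cases h₁ with
    | inn _ _ _ _ _ _ h₁ =>
      cases h₂ with
      | inn _ _ _ _ _ _ h₂ =>
        obtain ⟨d, h₃, h₄⟩ := (S n).dec _ _ _ _ _ _ h₁ h₂
        exact ⟨bk i n d, h₃.lift fun _ _ _ _ h => .inn _ _ _ _ _ _ h,
          h₄.lift fun _ _ _ _ h => .inn _ _ _ _ _ _ h⟩
  | rt T κ =>
    cases h₁ with
    | rc _ _ i _ h =>
      cases h₂ with
      | rc _ _ _ _ h' => simp [h] at h'
      | rb _ _ j => exact h ▸ (bip_peak hγ ho T κ i j).symm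
    | rb _ _ j _ h =>
      cases h₂ with
      | rb _ _ _ _ h' => simp [h] at h'
      | rc _ _ i => exact h ▸ bip_peak hγ ho T κ i j
  | c T κ i =>
    have : t = T := by cases h₁ <;> assumption
    have : (!t) = T := by cases h₂ <;> assumption
    simp_all
  | b T κ j =>
    have : t = !T := by cases h₁ <;> assumption
    have : (!t) = !T := by cases h₂ <;> assumption
    simp_all
  | om => cases h₁

theorem bip_le (ho : ∀ n, o n < γ) (t l p q) (h : BipE γ S t l p q) : l ≤ γ := by
  cases h with
  | inn _ n _ _ _ _ h => exact ((S n).le _ _ _ _ h).trans (ho n).le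
  | rc => exact le_rfl
  | _ => exact bot_le

theorem bip_emb (i n : I) : Emb (S n).E (BipE γ S) (bk i n) fun _ _ => False where
  inj x y h := by simpa using h
  step := by
    rintro t x z ⟨l, h⟩
    cases h with
    | inn _ _ _ _ _ v' h => exact .inl ⟨v', rfl, l, h⟩
  lift := by
    rintro t x y ⟨l, h⟩
    exact ⟨l, .inn _ _ _ _ _ _ h⟩
  closed _ _ _ h _ := h
  notMem _ _ h := h
  disj _ h _ := h

theorem bk_reach {t i n v p} (h : ReflTransGen (Under (BipE γ S) t) (bk i n v) p) :
    ∃ v', p = bk i n v' := by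
  rcases (bip_emb i n).under_path h with ⟨v', h, -⟩ | h
  exacts [⟨v', h⟩, h.elim]

theorem om_reach {t T κ i j p} (h : ReflTransGen (Under (BipE γ S) t) (om T κ i j) p) :
    p = om T κ i j := by
  rcases h.cases_head with h | ⟨_, ⟨_, ⟨⟩⟩, -⟩
  exact h.symm

theorem c_reach {t T κ i p} (h : ReflTransGen (Under (BipE γ S) t) (c T κ i) p) :
    p = c T κ i ∨ t = T ∧ ((∃ j, p = om T κ i j ∧ j i = none) ∨ ∃ q : Choice S T κ,
      ReflTransGen (Under (BipE γ S) t) (bk i q.n q.x) p) := by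
  rcases h.cases_head with h | ⟨_, ⟨_, h⟩, hp⟩
  · exact .inl h.symm
  · cases h with
    | cx _ _ _ _ q h => exact .inr ⟨h, .inr ⟨q, hp⟩⟩
    | co _ _ _ j _ h hj => exact .inr ⟨h, .inl ⟨j, om_reach hp, hj⟩⟩

theorem b_reach {t T κ j p} (h : ReflTransGen (Under (BipE γ S) t) (b T κ j) p) :
    p = b T κ j ∨ (t = !T) ∧ ((∃ i, p = om T κ i j ∧ j i = none) ∨ ∃ i q, j i = some q ∧
      ReflTransGen (Under (BipE γ S) t) (bk i q.n q.x') p) := by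
  rcases h.cases_head with h | ⟨_, ⟨_, h⟩, hp⟩
  · exact .inl h.symm
  · cases h with
    | bx _ _ i _ _ q h hj => exact .inr ⟨h, .inr ⟨i, q, hj, hp⟩⟩
    | bo _ _ i _ _ h hj => exact .inr ⟨h, .inl ⟨i, om_reach hp, hj⟩⟩

theorem under_rt {t T κ p} (h : Under (BipE γ S) t (rt T κ) p) :
    (t = !T) ∧ (∃ i, p = c T κ i) ∨ t = T ∧ ∃ j, p = b T κ j := by
  obtain ⟨_, h⟩ := h
  cases h with
  | rc _ _ i _ h => exact .inl ⟨h, i, rfl⟩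
  | rb _ _ j _ h => exact .inr ⟨h, j, rfl⟩

/-- The target of a step from a root has no steps of the same type. -/
theorem child_reach {t T κ p d} (h : Under (BipE γ S) t (rt T κ) p)
    (hp : ReflTransGen (Under (BipE γ S) t) p d) : d = p := by
  rcases under_rt h with ⟨rfl, i, rfl⟩ | ⟨rfl, j, rfl⟩
  · rcases c_reach hp with h | ⟨h, -⟩
    · exact h
    · simp at h
  · rcases b_reach hp with h | ⟨h, -⟩
    · exact h
    · simp at h

/-- A common reduct of a root and the target of a step from a root is this target. -/
theorem child_join {t T κ T₁ κ₁ p d} (h : Under (BipE γ S) t (rt T κ) p)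
    (hp : ReflTransGen (Under (BipE γ S) (!t)) p d)
    (hd : d = rt T₁ κ₁ ∨ Under (BipE γ S) t (rt T₁ κ₁) d) : T₁ = T ∧ κ₁ = κ ∧ d = p := by
  replace hd : d = rt T₁ κ₁ ∨ (∃ i, d = c T₁ κ₁ i) ∨ ∃ j, d = b T₁ κ₁ j :=
    hd.imp_right fun h => (under_rt h).imp And.right And.right
  rcases under_rt h with ⟨rfl, i, rfl⟩ | ⟨rfl, j, rfl⟩
  · rcases c_reach hp with h | ⟨-, ⟨j, h, -⟩ | ⟨q, h⟩⟩
    · subst h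
      simpa [eq_comm, and_assoc] using hd
    · simp [h] at hd
    · obtain ⟨v, h⟩ := bk_reach h
      simp [h] at hd
  · rcases b_reach hp with h | ⟨-, ⟨j, h, -⟩ | ⟨i, q, -, h⟩⟩
    · subst h
      rcases hd with h | ⟨_, h⟩ | ⟨j', h⟩ <;> cases h
      exact ⟨rfl, rfl, rfl⟩
    · simp [h] at hd
    · obtain ⟨v, h⟩ := bk_reach h
      simp [h] at hd

/-- The designated steps of the limit construction: all steps from a root. -/
def BipDes (γ : Ordinal.{0}) (S : ∀ n, Sys (o n) (V n)) (t _κ : Bool) (p q : BipV S) : Prop :=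
  (∃ T κ, p = rt T κ) ∧ Under (BipE γ S) t p q

theorem bip_rigid (t κ) (x x' x₁ x₁' d : BipV S) (hx : BipDes γ S t κ x x')
    (hx₁ : BipDes γ S t κ x₁ x₁') (h₁ : ReflTransGen (Under (BipE γ S) t) x₁ d)
    (h₂ : ReflTransGen (Under (BipE γ S) (!t)) x' d) : x₁ = x ∧ d ≠ x ∧
      ∀ z, Under (BipE γ S) t x z → ReflTransGen (Under (BipE γ S) t) z d → z = x' := by
  obtain ⟨⟨T, κ, rfl⟩, hx⟩ := hx
  obtain ⟨⟨T₁, κ₁, rfl⟩, -⟩ := hx₁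
  have hd : d = rt T₁ κ₁ ∨ Under (BipE γ S) t (rt T₁ κ₁) d := by
    rcases h₁.cases_head with h | ⟨p, h, hp⟩
    · exact .inl h.symm
    · exact .inr (child_reach h hp ▸ h)
  obtain ⟨rfl, rfl, rfl⟩ := child_join hx h₂ hd
  refine ⟨rfl, ?_, fun z hz h => (child_reach hz h).symm⟩
  rcases under_rt hx with ⟨-, i, rfl⟩ | ⟨-, j, rfl⟩ <;> simp

theorem exists_bound {f : Bool → Bool → Ordinal.{0}} (hf : ∀ T κ, f T κ < γ) :
    ∃ ξ < γ, ∀ T κ, f T κ ≤ ξ := by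
  refine ⟨max (max (f false false) (f false true)) (max (f true false) (f true true)),
    by simp [hf], ?_⟩
  rintro (_ | _) (_ | _) <;> simp

/-- There is a selection of expensive steps of the same kind in cofinally many banks, which
majorise given bounds. -/
theorem exists_choice {F : Lbl (BipV S)} (ho : ∀ n, o n < γ) (hcof : ∀ ξ < γ, ∃ n, ξ < o n)
    (hd : Dec F)
    (hF : ∀ t x y, Under F t x y ↔ Under (BipE γ S) t x y)
    {f : I → Bool → Bool → Ordinal.{0}} (hf : ∀ i T κ, f i T κ < γ) :
    ∃ T κ, ∃ j : I → Option (Choice S T κ),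
      (∀ ξ < γ, ∃ i q, j i = some q ∧ ξ < o q.n) ∧
      ∀ i q, j i = some q → f i T κ < o q.n ∧
        ∀ l, F T l (bk i q.n q.x) (bk i q.n q.x') → o q.n ≤ l := by
  have hn : ∀ i, ∃ n, o i < o n ∧ ∀ T κ, f i T κ < o n := fun i => by
    obtain ⟨ξ, hξ, h⟩ := exists_bound (hf i)
    obtain ⟨n, hn⟩ := hcof (max ξ (o i)) (max_lt hξ (ho i))
    exact ⟨n, (le_max_right _ _).trans_lt hn, fun T κ =>
      ((h T κ).trans (le_max_left _ _)).trans_lt hn⟩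
  choose n hin hfn using hn
  choose T κ x x' hx hl using fun i => (S (n i)).force _ ((bip_emb i (n i)).dec_pull hF hd)
    ((bip_emb i (n i)).under_pull hF)
  obtain ⟨T₀, κ₀, h₀⟩ : ∃ T₀ κ₀, ∀ ξ < γ, ∃ i, ξ < o i ∧ T i = T₀ ∧ κ i = κ₀ := by
    by_contra! H
    choose g hgγ hg using H
    obtain ⟨ξ, hξ, h⟩ := exists_bound hgγ
    obtain ⟨i, hi⟩ := hcof ξ hξ
    exact hg _ _ i ((h _ _).trans_lt hi) rfl rfl
  refine ⟨T₀, κ₀, fun i => if h : T i = T₀ ∧ κ i = κ₀ then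
    some ⟨n i, x i, x' i, h.1 ▸ h.2 ▸ hx i⟩ else none, fun ξ hξ => ?_, fun i q hq => ?_⟩
  · obtain ⟨i, hi, h⟩ := h₀ ξ hξ
    exact ⟨i, _, dif_pos h, hi.trans (hin i)⟩
  · dsimp only at hq
    split_ifs at hq with h
    obtain rfl := Option.some.inj hq
    exact ⟨hfn i _ _, h.1 ▸ hl i⟩

theorem bip_force (ho : ∀ n, o n < γ) (hcof : ∀ ξ < γ, ∃ n, ξ < o n)
    (F : Lbl (BipV S)) (hd : Dec F)
    (hF : ∀ t x y, Under F t x y ↔ Under (BipE γ S) t x y) :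
    ∃ t κ p q, BipDes γ S t κ p q ∧ ∀ i, F t i p q → γ ≤ i := by
  by_contra! H
  have hc : ∀ i T κ, ∃ l, F (!T) l (rt T κ) (c T κ i) ∧ l < γ := fun i T κ =>
    H _ false _ _ ⟨⟨T, κ, rfl⟩, γ, .rc _ _ _ _ rfl⟩
  choose f hf hfγ using hc
  obtain ⟨T, κ, j, hj, hj'⟩ := exists_choice ho hcof hd hF hfγ
  obtain ⟨l, hl, hlγ⟩ := H T false (rt T κ) (b T κ j) ⟨⟨T, κ, rfl⟩, 0, .rb _ _ _ _ rfl⟩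
  obtain ⟨i, q, hi, hq⟩ := hj l hlγ
  obtain ⟨hfq, hx⟩ := hj' i q hi
  obtain ⟨d, k, k', h₁, h₂⟩ := hd.ph (M := max l (f i T κ)) (φ := false) (ψ := false)
    ⟨l, hl, le_max_left _ _, by simp⟩ ⟨_, hf i T κ, le_max_right _ _, by simp⟩
  have under : ∀ {t M} {p q : BipV S × Bool}, ReflTransGen (Ph F t M) p q →
      ReflTransGen (Under (BipE γ S) t) p.1 q.1 := fun hp =>
    rtg_mono (ph_path_under hp) fun _ _ => (hF _ _ _).1
  rcases h₁.cases_head with h | ⟨⟨p, k₁⟩, h₃, h₁⟩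
  · cases h
    rcases b_reach (under h₂) with h | ⟨-, ⟨_, h, -⟩ | ⟨_, _, -, h⟩⟩
    · cases h
    · cases h
    · obtain ⟨_, h⟩ := bk_reach h
      cases h
  obtain ⟨_, h⟩ := (hF _ _ _).1 h₃.under
  cases h with
  | co _ _ _ j' _ _ h₄ =>
    obtain rfl := om_reach (under h₁)
    rcases b_reach (under h₂) with h | ⟨-, ⟨_, h, h₅⟩ | ⟨_, _, -, h⟩⟩
    · cases h
    · cases h
      simp [h₅] at hi
    · obtain ⟨_, h⟩ := bk_reach h
      cases h
  | cx _ _ _ _ q₁ _ =>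
    obtain ⟨v, rfl⟩ := bk_reach (under h₁)
    rcases b_reach (under h₂) with h | ⟨-, ⟨_, h, -⟩ | ⟨i', q', hq', h⟩⟩
    · cases h
    · cases h
    · obtain ⟨v', hv⟩ := bk_reach h
      obtain ⟨rfl, hn, -⟩ : i = i' ∧ q₁.n = q'.n ∧ v ≍ v' := by simpa using hv
      obtain rfl : q = q' := by simpa [hi] using hq'
      obtain ⟨n, x, x', hx'⟩ := q
      obtain ⟨n₁, x₁, x₁', hx₁'⟩ := q₁
      obtain rfl : n₁ = n := hn
      obtain ⟨-, l', h₅, h₆, -⟩ := (S n₁).bd_of_join (bip_emb i n₁) hF hx' hx₁' h₁ h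
      exact ((hx l' h₅).trans h₆).not_gt (max_lt hq hfq)

/-- The limit construction. -/
def bip (hγ : 0 < γ) (ho : ∀ n, o n < γ) (hcof : ∀ ξ < γ, ∃ n, ξ < o n)
    (S : ∀ n, Sys (o n) (V n)) : Sys γ (BipV S) where
  E := BipE γ S
  dec := bip_dec hγ ho
  le := bip_le ho
  des := BipDes γ S
  des_under _ _ _ _ h := h.2
  rigid := bip_rigid
  force := bip_force ho hcof

end limit

theorem exists_sys (γ : Ordinal.{0}) : ∃ V, Nonempty (Sys γ V) := by
  induction γ using Ordinal.limitRecOn with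
  | zero => exact ⟨_, ⟨base⟩⟩
  | add_one γ ih =>
    obtain ⟨V, ⟨S⟩⟩ := ih
    exact ⟨_, ⟨S.strip⟩⟩
  | limit γ hγ ih =>
    choose V S using fun n : γ.ToType => ih (Ordinal.ToType.toOrd n) (Ordinal.ToType.toOrd n).2
    refine ⟨_, ⟨bip hγ.bot_lt (fun n => (Ordinal.ToType.toOrd n).2) (fun ξ hξ => ?_)
      fun n => (S n).some⟩⟩
    exact ⟨Ordinal.ToType.mk ⟨ξ + 1, hγ.add_one_lt hξ⟩, by simp⟩

end Sys

end DecHier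

/-- if level `α+1` of the DC hierarchy does not collapse to level `α`,
then no level `β < α` collapses to level `α`; also for countable systems. -/
theorem stmt17 (α : Ordinal.{0}) :
    ((∃ (A : Type) (r s : A → A → Prop), Nonempty A ∧ DCord (α + 1) r s ∧ ¬ DCord α r s) →
      ∀ β : Ordinal.{0}, β < α →
        ∃ (A : Type) (r s : A → A → Prop), Nonempty A ∧ DCord α r s ∧ ¬ DCord β r s) ∧
    ((∃ (A : Type) (r s : A → A → Prop), Nonempty A ∧ (∃ h : ℕ → A, Function.Surjective h) ∧
        DCord (α + 1) r s ∧ ¬ DCord α r s) →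
      ∀ β : Ordinal.{0}, β < α →
        ∃ (A : Type) (r s : A → A → Prop), Nonempty A ∧ (∃ h : ℕ → A, Function.Surjective h) ∧
          DCord α r s ∧ ¬ DCord β r s) := by
  constructor
  · rintro - β hβ
    obtain ⟨V, ⟨S⟩⟩ := DecHier.Sys.exists_sys β
    exact ⟨V, _, _, S.nonempty,
      DecHier.DCord_mono (Order.add_one_le_iff.2 hβ) (DecHier.DCord_succ S.dec S.le), S.not_DCord⟩
  · rintro ⟨A, r, s, -, ⟨h, hh⟩, h₁, h₂⟩ β hβ
    have := hh.countable
    have hα : α < Ordinal.omega 1 := not_le.1 fun hα =>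
      h₂ (DecHier.DCord_mono hα (DecHier.DCord_omega_one h₁))
    have hc : β.card ≤ Cardinal.aleph0 := by
      have := Cardinal.lt_ord.1 (Cardinal.ord_aleph 1 ▸ hβ.trans hα)
      rwa [← Cardinal.succ_aleph0, Order.lt_succ_iff] at this
    obtain ⟨V, hV, ⟨C⟩⟩ := DecHier.Chain.exists_chain β hc
    have : Nonempty V := ⟨C.A⟩
    exact ⟨V, _, _, this, exists_surjective_nat V,
      DecHier.DCord_mono (Order.add_one_le_iff.2 hβ) (DecHier.DCord_succ C.dec C.le), C.not_DCord⟩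
end

section
/- The union of the classes DC_n over all n ∈ ℕ is strictly contained in DC_ω, even restricted to countable systems: there exists a countable ARS with two relations that belongs to DC_ω but does not belong to DC_n for any n ∈ ℕ. -/
open Relation Function FirstOrder

lemma Relation.ReflTransGen.imp {α : Type*} {r p : α → α → Prop} {a b : α}
    (h : Relation.ReflTransGen r a b) (hrp : ∀ x y, r x y → p x y) :
    Relation.ReflTransGen p a b :=
  h.lift id hrp

namespace Tower

/-- The nine vertices which a gadget adds above an edge. -/
inductive Pt
  | p0 | p1 | q0 | q1 | b0 | b1 | b2 | top | side
  deriving Countable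

/-- The sixteen edges which a gadget adds above an edge. -/
inductive Tag
  | pp | qq | bb0 | bb1 | ts
  | p0u | p1v | q0u | q1v | b0p0 | b1p1 | b1q0 | b2p1 | b2q1 | topb0 | sideb2
  deriving Countable

/-- The source of a gadget edge. -/
def Tag.src : Tag → Pt
  | .pp => .p0 | .qq => .q0 | .bb0 => .b0 | .bb1 => .b1 | .ts => .top
  | .p0u => .p0 | .p1v => .p1 | .q0u => .q0 | .q1v => .q1 | .b0p0 => .b0
  | .b1p1 => .b1 | .b1q0 => .b1 | .b2p1 => .b2 | .b2q1 => .b2 | .topb0 => .top | .sideb2 => .side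

/-- Whether a gadget edge has the same colour as the edge the gadget sits on. -/
def Tag.same : Tag → Bool
  | .pp => true | .qq => true | .bb0 => true | .bb1 => true | .ts => true
  | _ => false

/-- Edges are lists of tags: `[]` is the base edge, and `t :: l` is the edge tagged `t` of the
gadget on the edge `l`. Vertices are the two endpoints of the base edge and the gadget points. -/
abbrev Vertex := Bool ⊕ (List Tag × Pt)

/-- The source of an edge. -/
def src : List Tag → Vertex
  | [] => .inl true
  | t :: l => .inr (l, t.src)

/-- The target of an edge. -/
def tgt : List Tag → Vertex
  | [] => .inl false
  | t :: l => match t with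
    | .pp => .inr (l, .p1) | .qq => .inr (l, .q1) | .bb0 => .inr (l, .b1) | .bb1 => .inr (l, .b2)
    | .ts => .inr (l, .side)
    | .p0u => src l | .p1v => tgt l | .q0u => src l | .q1v => tgt l
    | .b0p0 => .inr (l, .p0) | .b1p1 => .inr (l, .p1) | .b1q0 => .inr (l, .q0)
    | .b2p1 => .inr (l, .p1) | .b2q1 => .inr (l, .q1)
    | .topb0 => .inr (l, .b0) | .sideb2 => .inr (l, .b2)

/-- The colour of an edge. -/
def col : List Tag → Bool
  | [] => true
  | t :: l => bif t.same then col l else !col l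

/-- The steps of a given colour. -/
def R (c : Bool) (x y : Vertex) : Prop := ∃ e, col e = c ∧ src e = x ∧ tgt e = y

/-- The height of a point inside its gadget. -/
def height : Pt → ℕ
  | .p0 => 2 | .p1 => 0 | .q0 => 1 | .q1 => 0 | .b0 => 3 | .b1 => 2 | .b2 => 1
  | .top => 4 | .side => 2

/-- A measure which decreases along every edge. -/
def rank : Vertex → ℕ
  | .inl b => bif b then 1 else 0
  | .inr (l, k) => 5 * (l.length + 1) + height k

lemma rank_inr (l : List Tag) (k : Pt) : rank (.inr (l, k)) = 5 * (l.length + 1) + height k := rfl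

lemma src_cons (t : Tag) (l : List Tag) : src (t :: l) = .inr (l, t.src) := rfl

lemma height_le (k : Pt) : height k ≤ 4 := by cases k <;> decide

lemma rank_src_lt (l : List Tag) : rank (src l) < 5 * (l.length + 1) := by
  cases l with
  | nil => simp [src, rank]
  | cons t l =>
    have := height_le t.src
    simp only [src_cons, rank_inr, List.length_cons]
    omega

lemma rank_tgt_lt (l : List Tag) : rank (tgt l) < 5 * (l.length + 1) := by
  induction l with
  | nil => simp [tgt, rank]
  | cons t l ih =>
    have := rank_src_lt l
    cases t <;> simp only [tgt, rank_inr, height, List.length_cons] <;> omega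

lemma rank_tgt_lt_rank_src (e : List Tag) : rank (tgt e) < rank (src e) := by
  cases e with
  | nil => simp [tgt, src, rank]
  | cons t l =>
    have := rank_src_lt l
    have := rank_tgt_lt l
    cases t <;> simp only [tgt, src_cons, Tag.src, rank_inr, height] <;> omega

lemma R.rank_lt {c : Bool} {x y : Vertex} (h : R c x y) : rank y < rank x := by
  obtain ⟨e, -, rfl, rfl⟩ := h
  exact rank_tgt_lt_rank_src e

lemma eq_or_rank_lt {c : Bool} {x y : Vertex} (h : ReflTransGen (R c) x y) :
    y = x ∨ rank y < rank x := by
  induction h with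
  | refl => exact .inl rfl
  | tail _ h ih =>
    have := h.rank_lt
    rcases ih with rfl | ih
    · exact .inr this
    · exact .inr (this.trans ih)

lemma R.exists_tag {c : Bool} {l : List Tag} {k : Pt} {z : Vertex} (h : R c (.inr (l, k)) z) :
    ∃ t : Tag, t.src = k ∧ col (t :: l) = c ∧ tgt (t :: l) = z := by
  obtain ⟨e, hc, hs, ht⟩ := h
  cases e with
  | nil => simp [src] at hs
  | cons t l' =>
    simp only [src, Sum.inr.injEq, Prod.mk.injEq] at hs
    obtain ⟨rfl, hk⟩ := hs
    exact ⟨t, hk, hc, ht⟩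

lemma R.of_tag (t : Tag) (l : List Tag) : R (col (t :: l)) (.inr (l, t.src)) (tgt (t :: l)) :=
  ⟨t :: l, rfl, rfl, rfl⟩

/-- Local commutation at a gadget point, for two tags of different colours. -/
lemma exists_join_of_tags (l : List Tag) (t t' : Tag) (h : t.src = t'.src)
    (ht : t.same = true) (ht' : t'.same = false) :
    ∃ d, ReflTransGen (R (!col l)) (tgt (t :: l)) d ∧
      ReflTransGen (R (col l)) (tgt (t' :: l)) d := by
  cases t <;> cases t' <;> simp only [Tag.src, Tag.same, reduceCtorEq] at h ht ht'
  · exact ⟨tgt l, .single (R.of_tag .p1v l), .single ⟨l, rfl, rfl, rfl⟩⟩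
  · exact ⟨tgt l, .single (R.of_tag .q1v l), .single ⟨l, rfl, rfl, rfl⟩⟩
  · exact ⟨.inr (l, .p1), .single (R.of_tag .b1p1 l), .single (R.of_tag .pp l)⟩
  · exact ⟨.inr (l, .p1), .single (R.of_tag .b2p1 l), .refl⟩
  · exact ⟨.inr (l, .q1), .single (R.of_tag .b2q1 l), .single (R.of_tag .qq l)⟩
  · exact ⟨.inr (l, .b2), .single (R.of_tag .sideb2 l),
      .head (R.of_tag .bb0 l) (.single (R.of_tag .bb1 l))⟩

lemma locally_commuting {c : Bool} {x y z : Vertex} (hy : R c x y) (hz : R (!c) x z) :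
    ∃ d, ReflTransGen (R (!c)) y d ∧ ReflTransGen (R c) z d := by
  rcases x with b | ⟨l, k⟩
  · obtain ⟨e, hc, hs, -⟩ := hy
    obtain ⟨e', hc', hs', -⟩ := hz
    cases e <;> cases e' <;> simp [src] at hs hs'
    rw [hc] at hc'
    cases c <;> simp at hc'
  · obtain ⟨t, hk, hc, rfl⟩ := hy.exists_tag
    obtain ⟨t', hk', hc', rfl⟩ := hz.exists_tag
    rcases ht : t.same with _ | _ <;> rcases ht' : t'.same with _ | _ <;>
      simp only [col, ht, ht', cond_true, cond_false] at hc hc'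
    · cases c <;> simp_all
    · obtain ⟨d, h, h'⟩ := exists_join_of_tags l t' t (hk'.trans hk.symm) ht' ht
      subst hc
      simp only [Bool.not_not]
      exact ⟨d, h', h⟩
    · obtain ⟨d, h, h'⟩ := exists_join_of_tags l t t' (hk.trans hk'.symm) ht ht'
      subst hc
      exact ⟨d, h, h'⟩
    · cases c <;> simp_all

lemma below_of_rank_lt {c : Bool} {I : Type*} {lt : I → I → Prop} {f : I → Vertex → Vertex → Prop}
    {α : I} {n : ℕ} (hf : ∀ x y, R c x y → rank x < n → Below lt f α x y) {x y : Vertex}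
    (h : ReflTransGen (R c) x y) (hx : rank x < n) : ReflTransGen (Below lt f α) x y := by
  induction h using ReflTransGen.head_induction_on with
  | refl => exact .refl
  | head h _ ih => exact .head (hf _ _ h hx) (ih (h.rank_lt.trans hx))

theorem dcord_omega0 : DCord Ordinal.omega0 (R true) (R false) := by
  let F (c : Bool) (i : {β : Ordinal.{0} // β < Ordinal.omega0}) (x y : Vertex) : Prop :=
    R c x y ∧ i.val = (rank x : Ordinal)
  have hF (c : Bool) (x y : Vertex) : R c x y ↔ ∃ i, F c i x y :=
    ⟨fun h => ⟨⟨rank x, Ordinal.natCast_lt_omega0 _⟩, h, rfl⟩, fun ⟨_, h, _⟩ => h⟩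
  refine ⟨F true, F false, hF true, hF false, ?_⟩
  rintro α β x y z ⟨hy, hα⟩ ⟨hz, -⟩
  obtain ⟨d, hyd, hzd⟩ := locally_commuting hy hz
  have hb (c : Bool) (u v : Vertex) (h : R c u v) (hu : rank u < rank x) :
      Below (fun i j : {β : Ordinal.{0} // β < Ordinal.omega0} => i.val < j.val) (F c) α u v :=
    ⟨⟨rank u, Ordinal.natCast_lt_omega0 _⟩, by simpa [hα] using hu, h, rfl⟩
  exact ⟨y, y, z, z, d, .refl, .inr rfl,
    (below_of_rank_lt (hb true) hyd hy.rank_lt).imp fun _ _ => .inl, .refl, .inr rfl,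
    (below_of_rank_lt (hb false) hzd hz.rank_lt).imp fun _ _ => .inl⟩

lemma eq_or_rank_lt_of_proxy {l : List Tag} {k : Pt} {d : Vertex}
    (hk : k = .p0 ∨ k = .p1 ∨ k = .q0 ∨ k = .q1)
    (h : ReflTransGen (R (!col l)) (.inr (l, k)) d) :
    d = .inr (l, k) ∨ rank d < 5 * (l.length + 1) := by
  rcases h.cases_head with rfl | ⟨z, hz, hzd⟩
  · exact .inl rfl
  · right
    obtain ⟨t, ht, hc, rfl⟩ := hz.exists_tag
    have hlt : rank (tgt (t :: l)) < 5 * (l.length + 1) := by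
      have := rank_src_lt l
      have := rank_tgt_lt l
      subst ht
      cases t <;> simp [Tag.src, Tag.same, col] at hk hc <;> simpa [tgt]
    rcases eq_or_rank_lt hzd with rfl | h
    · exact hlt
    · exact h.trans hlt

lemma eq_of_reach_proxy_target {l : List Tag} {k : Pt} {d : Vertex} (hk : k = .p1 ∨ k = .q1)
    (h : ReflTransGen (R (col l)) (.inr (l, k)) d) : d = .inr (l, k) := by
  rcases h.cases_head with rfl | ⟨z, hz, -⟩
  · rfl
  · obtain ⟨t, ht, hc, -⟩ := hz.exists_tag
    subst ht
    cases t <;> simp [Tag.src, Tag.same, col] at hk hc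

lemma eq_or_eq_of_reach_q0 {l : List Tag} {d : Vertex}
    (h : ReflTransGen (R (col l)) (.inr (l, .q0)) d) : d = .inr (l, .q0) ∨ d = .inr (l, .q1) := by
  rcases h.cases_head with rfl | ⟨z, hz, hzd⟩
  · exact .inl rfl
  · obtain ⟨t, ht, hc, rfl⟩ := hz.exists_tag
    right
    cases t <;> simp [Tag.src, Tag.same, col] at ht hc
    exact eq_of_reach_proxy_target (.inr rfl) hzd

/-- A path from the source of `e`, in the colour of `e`, which meets a path of the other colour
from the target of `e`, has to use the edge `e`. -/
theorem not_join_avoiding (e : List Tag) (d : Vertex)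
    (h : ReflTransGen (fun y z => R (col e) y z ∧ ¬ (y = src e ∧ z = tgt e)) (src e) d)
    (h' : ReflTransGen (R (!col e)) (tgt e) d) : False := by
  rcases h.cases_head with rfl | ⟨z, ⟨hz, hne⟩, hzd⟩
  · have := rank_tgt_lt_rank_src e
    rcases eq_or_rank_lt h' with h | h
    · rw [h] at this
      exact this.false
    · omega
  replace hzd := hzd.imp fun _ _ => And.left
  cases e with
  | nil =>
    obtain ⟨e, -, hs, rfl⟩ := hz
    cases e <;> simp [src] at hs hne
  | cons t l =>
    obtain ⟨t', ht', hc, rfl⟩ := hz.exists_tag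
    have hp (k : Pt) : ¬ rank (.inr (l, k)) < 5 * (l.length + 1) := by simp [rank]
    cases t <;> cases t' <;> simp [Tag.src, Tag.same, col] at ht' hc hne
    all_goals
      simp only [col, Tag.same, cond_false, Bool.not_not, tgt] at hzd h'
    · obtain rfl := eq_of_reach_proxy_target (.inl rfl) h'
      simpa [hp] using eq_or_rank_lt_of_proxy (by simp) hzd
    · rcases eq_or_eq_of_reach_q0 h' with rfl | rfl <;>
        simpa [hp] using eq_or_rank_lt_of_proxy (by simp) hzd
    · obtain rfl := eq_of_reach_proxy_target (.inl rfl) h'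
      simpa [hp] using eq_or_rank_lt_of_proxy (by simp) hzd
    · obtain rfl := eq_of_reach_proxy_target (.inr rfl) h'
      simpa [hp] using eq_or_rank_lt_of_proxy (by simp) hzd

/-- All labels of the edge `e` are at least `M`. -/
def Heavy (F : Bool → ℕ → Vertex → Vertex → Prop) (M : ℕ) (e : List Tag) : Prop :=
  ∀ k, F (col e) k (src e) (tgt e) → M ≤ k

/-- Decreasing commutation with labels in `ℕ`, for both orientations of a peak and with the second
path not recording its labels. -/
def Decreasing (F : Bool → ℕ → Vertex → Vertex → Prop) : Prop :=
  ∀ c α β x y z, F c α x y → F (!c) β x z → ∃ y' y'' d,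
    ReflTransGen (fun u v => ∃ k, k < α ∧ F (!c) k u v) y y' ∧
    (F (!c) β y' y'' ∨ y' = y'') ∧
    ReflTransGen (fun u v => ∃ k, (k < α ∨ k < β) ∧ F (!c) k u v) y'' d ∧
    ReflTransGen (R c) z d

/-- Every edge has a label which is at most `M`. -/
def Light (F : Bool → ℕ → Vertex → Vertex → Prop) (M : ℕ) : Prop :=
  ∀ e, ∃ k ≤ M, F (col e) k (src e) (tgt e)

section Bounded

variable {F : Bool → ℕ → Vertex → Vertex → Prop} {M : ℕ}

/-- If the edge `e` is not heavy, then a peak of `e` and an edge of the other colour is joined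
without using steps that have only labels `≥ M`. -/
lemma exists_light_join (hF : Decreasing F) (hM : Light F M) {e e' : List Tag}
    (hs : src e = src e') (hc : col e' = !col e) (he : ¬ Heavy F M e) :
    ∃ d, ReflTransGen (fun u v => ∃ k < M, F (col e) k u v) (tgt e') d ∧
      ReflTransGen (R (!col e)) (tgt e) d := by
  simp only [Heavy, not_forall, not_le] at he
  obtain ⟨β, hβ, hβM⟩ := he
  obtain ⟨α, hαM, hα⟩ := hM e'
  rw [hc, ← hs] at hα
  obtain ⟨y', y'', d, h1, h2, h3, h4⟩ := hF _ _ _ _ _ _ hα (by simpa using hβ)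
  simp only [Bool.not_not] at h1 h2 h3
  refine ⟨d, (h1.imp ?_).trans (.trans ?_ (h3.imp ?_)), h4⟩
  · rintro _ _ ⟨k, hk, h⟩
    exact ⟨k, by omega, h⟩
  · rcases h2 with h | rfl
    · exact .single ⟨β, hβM, h⟩
    · exact .refl
  · rintro _ _ ⟨k, hk, h⟩
    exact ⟨k, by omega, h⟩

lemma not_light_of_heavy {e : List Tag} (he : Heavy F M e) :
    ¬ ∃ k < M, F (col e) k (src e) (tgt e) :=
  fun ⟨k, hk, h⟩ => (he k h).not_gt hk

lemma heavy_proxy (hR : ∀ c k x y, F c k x y → R c x y) (hF : Decreasing F) (hM : Light F M)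
    {l : List Tag} (hl : Heavy F M l) {t t0 t1 : Tag}
    (ht : (t, t0, t1) = (.pp, .p0u, .p1v) ∨ (t, t0, t1) = (.qq, .q0u, .q1v)) :
    Heavy F M (t :: l) := by
  by_contra he
  have key : ∃ k, (k = .p1 ∨ k = .q1) ∧ tgt (t :: l) = .inr (l, k) ∧ tgt (t0 :: l) = src l ∧
      t.src = t0.src ∧ col (t :: l) = col l ∧ col (t0 :: l) = !col l := by
    rcases ht with h | h <;> simp only [Prod.mk.injEq] at h <;> obtain ⟨rfl, rfl, rfl⟩ := h <;>
      simp [tgt, Tag.src, col, Tag.same]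
  obtain ⟨k, hk, htgt, htgt0, hsrc, hcol, hcol0⟩ := key
  obtain ⟨d, h, h'⟩ := exists_light_join hF hM (e' := t0 :: l) (by simp [src, hsrc])
    (by rw [hcol, hcol0]) he
  rw [htgt0, hcol] at h
  rw [htgt, hcol] at h'
  rcases h'.cases_head with rfl | ⟨z, hz, hzd⟩
  · have := rank_src_lt l
    rcases eq_or_rank_lt (h.imp fun _ _ ⟨_, _, hk⟩ => hR _ _ _ _ hk) with h | h
    · rw [← h] at this
      simp [rank] at this
    · simp only [rank_inr] at h
      omega
  · obtain ⟨t', ht', hc', rfl⟩ := hz.exists_tag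
    have : tgt (t' :: l) = tgt l := by
      subst ht'
      cases t' <;> simp [Tag.src, Tag.same, col] at hk hc' <;> rfl
    rw [this] at hzd
    refine not_join_avoiding l d (h.imp ?_) hzd
    rintro u v ⟨k, hk, huv⟩
    refine ⟨hR _ _ _ _ huv, ?_⟩
    rintro ⟨rfl, rfl⟩
    exact not_light_of_heavy hl ⟨k, hk, huv⟩

/-- A point with a single outgoing step of its colour, which is heavy, has no light descendants. -/
lemma eq_of_light (hR : ∀ c k x y, F c k x y → R c x y) {l : List Tag} {t : Tag}
    (ht : t.same = true) (he : Heavy F M (t :: l)) {d : Vertex}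
    (h : ReflTransGen (fun u v => ∃ k < M, F (col l) k u v) (.inr (l, t.src)) d) :
    d = .inr (l, t.src) := by
  rcases h.cases_head with rfl | ⟨z, ⟨k, hk, hz⟩, -⟩
  · rfl
  · obtain ⟨t', ht', hc, rfl⟩ := (hR _ _ _ _ hz).exists_tag
    have : t' = t := by
      cases t <;> cases t' <;> simp [Tag.src, Tag.same, col] at ht ht' hc ⊢
    subst this
    refine absurd ⟨k, hk, ?_⟩ (not_light_of_heavy he)
    rw [hc]
    exact hz

lemma heavy_path (hR : ∀ c k x y, F c k x y → R c x y) (hF : Decreasing F) (hM : Light F M)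
    {l : List Tag} {t t0 t1 : Tag} (ht1 : Heavy F M (t1 :: l))
    (ht : (t, t0, t1) = (.bb0, .b0p0, .pp) ∨ (t, t0, t1) = (.bb1, .b1q0, .qq)) :
    Heavy F M (t :: l) := by
  by_contra he
  have key : tgt (t0 :: l) = .inr (l, t1.src) ∧ t1.same = true ∧ t.src = t0.src ∧
      col (t :: l) = col l ∧ col (t0 :: l) = !col l ∧ tgt (t :: l) ≠ .inr (l, t1.src) ∧
      rank (tgt (t :: l)) ≤ rank (.inr (l, t1.src)) := by
    rcases ht with h | h <;> simp only [Prod.mk.injEq] at h <;> obtain ⟨rfl, rfl, rfl⟩ := h <;>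
      simp [tgt, Tag.src, col, Tag.same, rank, height]
  obtain ⟨htgt0, hsame, hsrc, hcol, hcol0, hne, hrank⟩ := key
  obtain ⟨d, h, h'⟩ := exists_light_join hF hM (e' := t0 :: l) (by simp [src, hsrc])
    (by rw [hcol, hcol0]) he
  rw [htgt0, hcol] at h
  obtain rfl := eq_of_light hR hsame ht1 h
  rcases eq_or_rank_lt h' with h | h
  · exact hne h.symm
  · omega

lemma not_heavy (hR : ∀ c k x y, F c k x y → R c x y) (hF : Decreasing F) (hM : Light F M)
    (l : List Tag) : ¬ Heavy F M l := by
  intro hl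
  have h0 : Heavy F M (.bb0 :: l) :=
    heavy_path hR hF hM (heavy_proxy hR hF hM hl (.inl rfl)) (.inl rfl)
  have h1 : Heavy F M (.bb1 :: l) :=
    heavy_path hR hF hM (heavy_proxy hR hF hM hl (.inr rfl)) (.inr rfl)
  obtain ⟨β, hβM, hβ⟩ := hM (.ts :: l)
  obtain ⟨α, hαM, hα⟩ := hM (.topb0 :: l)
  obtain ⟨y', y'', d, s1, s2, s3, s4⟩ := hF (!col l) α β _ _ _ hα (by rw [Bool.not_not]; exact hβ)
  simp only [Bool.not_not] at s1 s2 s3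
  obtain rfl : y' = .inr (l, .b0) := eq_of_light (t := .bb0) hR rfl h0
    (s1.imp fun _ _ ⟨k, hk, h⟩ => ⟨k, by omega, h⟩)
  replace s3 := s3.imp (p := fun u v => ∃ k < M, F (col l) k u v)
    fun _ _ ⟨k, hk, h⟩ => ⟨k, by omega, h⟩
  have hd : d = .inr (l, .b0) ∨ d = .inr (l, .b1) := by
    rcases s2 with h | rfl
    · obtain ⟨t, ht, hc, rfl⟩ := (hR _ _ _ _ h).exists_tag
      cases t <;> simp [Tag.src, Tag.same, col] at ht hc
      exact .inr (eq_of_light (t := .bb1) hR rfl h1 s3)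
    · exact .inl (eq_of_light (t := .bb0) hR rfl h0 s3)
  rcases hd with rfl | rfl <;> simpa [tgt, rank, height] using eq_or_rank_lt s4

/-- A labelling by finitely many natural numbers is not decreasing. -/
theorem not_decreasing_of_bounded (n : ℕ) (hR : ∀ c x y, R c x y ↔ ∃ k, F c k x y)
    (hn : ∀ c k x y, F c k x y → k < n) : ¬ Decreasing F := by
  intro hF
  have hex (e : List Tag) : ∃ k, F (col e) k (src e) (tgt e) := (hR _ _ _).1 ⟨e, rfl, rfl, rfl⟩
  classical
  let lab (e : List Tag) : ℕ := Nat.find (hex e)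
  have hlab (e : List Tag) : F (col e) (lab e) (src e) (tgt e) := Nat.find_spec (hex e)
  obtain ⟨e, he⟩ : ∃ e, ∀ e', lab e' ≤ lab e := by
    refine ⟨argmin fun e => n - lab e, fun e' => ?_⟩
    have h := argmin_le (fun e => n - lab e) e'
    have := hn _ _ _ _ (hlab e')
    have := hn _ _ _ _ (hlab (argmin fun e => n - lab e))
    omega
  exact not_heavy (M := lab e) (fun c k x y h => (hR _ _ _).2 ⟨k, h⟩) hF
    (fun e' => ⟨lab e', he e', hlab e'⟩) e fun k hk => Nat.find_min' (hex e) hk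

end Bounded

theorem not_dcord_natCast (n : ℕ) : ¬ DCord (n : Ordinal) (R true) (R false) := by
  rintro ⟨f, g, hf, hg, hfg⟩
  let F (c : Bool) (k : ℕ) (x y : Vertex) : Prop :=
    ∃ h : (k : Ordinal.{0}) < n, (bif c then f else g) ⟨k, h⟩ x y
  have hnat (i : {β : Ordinal.{0} // β < n}) :
      ∃ (k : ℕ) (h : (k : Ordinal.{0}) < n), i = ⟨k, h⟩ := by
    obtain ⟨k, hk⟩ := Ordinal.lt_omega0.1 (i.2.trans (Ordinal.natCast_lt_omega0 n))
    exact ⟨k, hk ▸ i.2, Subtype.ext hk⟩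
  have hex (c : Bool) (x y : Vertex) :
      (∃ i, (bif c then f else g) i x y) ↔ ∃ k, F c k x y := by
    constructor
    · rintro ⟨i, hi⟩
      obtain ⟨k, h, rfl⟩ := hnat i
      exact ⟨k, h, hi⟩
    · rintro ⟨k, h, hi⟩
      exact ⟨_, hi⟩
  have hR (c : Bool) (x y : Vertex) : R c x y ↔ ∃ k, F c k x y := by
    rw [← hex]
    cases c
    · exact hg x y
    · exact hf x y
  refine not_decreasing_of_bounded n hR (fun c k x y ⟨h, _⟩ => by exact_mod_cast h) ?_
  have hbelow (c : Bool) (i j : {β : Ordinal.{0} // β < n}) (a b : ℕ) (hi : i.val = a)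
      (hj : j.val = b) (x y : Vertex)
      (h : Below (fun i j : {β : Ordinal.{0} // β < n} => i.val < j.val)
          (bif c then f else g) i x y ∨
        Below (fun i j : {β : Ordinal.{0} // β < n} => i.val < j.val)
          (bif c then f else g) j x y) :
      ∃ k, (k < a ∨ k < b) ∧ F c k x y := by
    rcases h with ⟨l, hl, h⟩ | ⟨l, hl, h⟩ <;> obtain ⟨k, hk, rfl⟩ := hnat l
    · exact ⟨k, .inl (by simpa [hi] using hl), hk, h⟩
    · exact ⟨k, .inr (by simpa [hj] using hl), hk, h⟩
  have hreach (c : Bool) (x y : Vertex) (i : {β : Ordinal.{0} // β < n})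
      (h : Below (fun i j : {β : Ordinal.{0} // β < n} => i.val < j.val)
          (bif c then f else g) i x y) : R c x y := by
    obtain ⟨l, -, h⟩ := h
    exact (hR c x y).2 ((hex c x y).1 ⟨l, h⟩)
  have hjoin (c : Bool) (x y z w : Vertex) (i j k : {β : Ordinal.{0} // β < n})
      (h1 : ReflTransGen (Below (fun i j : {β : Ordinal.{0} // β < n} => i.val < j.val)
          (bif c then f else g) i) x y)
      (h2 : (bif c then f else g) j y z ∨ y = z)
      (h3 : ReflTransGen (fun u v => Below
            (fun i j : {β : Ordinal.{0} // β < n} => i.val < j.val) (bif c then f else g) i u v ∨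
          Below (fun i j : {β : Ordinal.{0} // β < n} => i.val < j.val)
            (bif c then f else g) k u v) z w) : ReflTransGen (R c) x w := by
    refine (h1.imp fun _ _ => hreach c _ _ i).trans (.trans ?_ (h3.imp fun _ _ h =>
      h.elim (hreach c _ _ i) (hreach c _ _ k)))
    rcases h2 with h2 | rfl
    · exact .single ((hR c _ _).2 ((hex c _ _).1 ⟨j, h2⟩))
    · exact .refl
  rintro c α β x y z ⟨hα, hy⟩ ⟨hβ, hz⟩
  cases c with
  | false =>
    obtain ⟨b', b'', c', c'', d, h1, h2, h3, h4, h5, h6⟩ := hfg _ _ _ _ _ hy hz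
    refine ⟨b', b'', d, h1.imp fun u v h => ?_, h2.imp_left fun h => ⟨hβ, h⟩,
      h3.imp fun u v h => hbelow true _ _ α β rfl rfl u v h, ?_⟩
    · simpa using hbelow true ⟨α, hα⟩ ⟨α, hα⟩ α α rfl rfl u v (.inl h)
    · exact hjoin false _ _ _ _ ⟨β, hβ⟩ ⟨α, hα⟩ ⟨α, hα⟩ h4 h5 (h6.imp fun _ _ => Or.symm)
  | true =>
    obtain ⟨b', b'', c', c'', d, h1, h2, h3, h4, h5, h6⟩ := hfg _ _ _ _ _ hz hy
    refine ⟨c', c'', d, h4.imp fun u v h => ?_, h5.imp_left fun h => ⟨hβ, h⟩,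
      h6.imp fun u v h => hbelow false _ _ α β rfl rfl u v h.symm, ?_⟩
    · simpa using hbelow false ⟨α, hα⟩ ⟨α, hα⟩ α α rfl rfl u v (.inl h)
    · exact hjoin true _ _ _ _ ⟨β, hβ⟩ ⟨α, hα⟩ ⟨α, hα⟩ h1 h2 (h3.imp fun _ _ => id)

end Tower

/-- the union of the `DC_n` is strictly contained in `DC_ω`,
even for countable systems. -/
theorem stmt19 :
    ∃ (A : Type) (r s : A → A → Prop),
      Nonempty A ∧ (∃ h : ℕ → A, Function.Surjective h) ∧
      DCord Ordinal.omega0 r s ∧ ∀ n : ℕ, ¬ DCord (n : Ordinal) r s := by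
  exact ⟨Tower.Vertex, Tower.R true, Tower.R false, ⟨.inl true⟩, exists_surjective_nat _,
    Tower.dcord_omega0, Tower.not_dcord_natCast⟩
end
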